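/- arXiv:1109.6437 — 4 statements merged into one kernel-verified Lean document; each statement's English description precedes it below -/
import Mathlib

section
/- For every real number s > 2, the Epstein zeta function of the lattice ℤ⁴ satisfies ζ_{ℤ⁴}(s) = 8·(1 − 4^{1−s})·ζ(s)·ζ(s−1), where ζ is the Riemann zeta function. In particular the defining series converges for s > 2. -/
open scoped BigOperators

/-- The Riemann zeta function as a real series `∑_{n ≥ 1} n^{-s}`. -/
noncomputable def rzeta (s : ℝ) : ℝ := ∑' n : ℕ+, (n : ℝ) ^ (-s)

section

open Finset

/-- The pairs of positive integers with product `n`. -/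
noncomputable def factorPairs (n : ℤ) : Finset (ℤ × ℤ) :=
  (Icc 1 n ×ˢ Icc 1 n).filter fun p => p.1 * p.2 = n

lemma mem_factorPairs {n : ℤ} {p : ℤ × ℤ} :
    p ∈ factorPairs n ↔ 0 < p.1 ∧ 0 < p.2 ∧ p.1 * p.2 = n := by
  simp only [factorPairs, mem_filter, mem_product, mem_Icc]
  constructor
  · rintro ⟨⟨⟨h1, -⟩, h2, -⟩, h⟩
    exact ⟨by omega, by omega, h⟩
  · rintro ⟨h1, h2, h⟩
    exact ⟨⟨⟨by omega, by nlinarith⟩, by omega, by nlinarith⟩, h⟩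

/-- The triples `(i, d, e)` with `d, e > 0` and `i ^ 2 + d * e = n`. -/
noncomputable def squareAddFactorTriples (n : ℤ) : Finset (ℤ × ℤ × ℤ) :=
  (Icc (-n) n ×ˢ Icc 1 n ×ˢ Icc 1 n).filter fun t => t.1 ^ 2 + t.2.1 * t.2.2 = n

lemma mem_squareAddFactorTriples {n : ℤ} {t : ℤ × ℤ × ℤ} :
    t ∈ squareAddFactorTriples n ↔ 0 < t.2.1 ∧ 0 < t.2.2 ∧ t.1 ^ 2 + t.2.1 * t.2.2 = n := by
  simp only [squareAddFactorTriples, mem_filter, mem_product, mem_Icc]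
  constructor
  · rintro ⟨⟨-, ⟨h1, -⟩, h2, -⟩, h⟩
    exact ⟨by omega, by omega, h⟩
  · rintro ⟨h1, h2, h⟩
    have h3 : 0 < t.2.1 * t.2.2 := mul_pos h1 h2
    have h4 := Int.le_self_sq t.1
    have h5 := Int.le_self_sq (-t.1)
    have h6 := sq_nonneg t.1
    exact ⟨⟨⟨by nlinarith, by nlinarith⟩, ⟨by omega, by nlinarith⟩, by omega, by nlinarith⟩, h⟩

lemma sum_squareAddFactorTriples (n : ℤ) (f : ℤ × ℤ × ℤ → ℤ) :
    ∑ t ∈ squareAddFactorTriples n, f t =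
      ∑ i ∈ Icc (-n) n, ∑ p ∈ factorPairs (n - i ^ 2), f (i, p) := by
  refine sum_finset_product _ _ _ fun t => ?_
  rw [mem_factorPairs]
  constructor
  · intro h
    have h' := mem_squareAddFactorTriples.1 h
    simp only [squareAddFactorTriples, mem_filter, mem_product] at h
    exact ⟨h.1.1, h'.1, h'.2.1, by linarith [h'.2.2]⟩
  · rintro ⟨-, h1, h2, h⟩
    exact mem_squareAddFactorTriples.2 ⟨h1, h2, by linarith⟩

lemma sum_squareAddFactorTriples_neg (n : ℤ) (f : ℤ × ℤ × ℤ → ℤ) :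
    ∑ t ∈ squareAddFactorTriples n, f (-t.1, t.2) = ∑ t ∈ squareAddFactorTriples n, f t := by
  refine sum_nbij' (fun t => (-t.1, t.2)) (fun t => (-t.1, t.2)) ?_ ?_ ?_ ?_ ?_ <;>
    simp [mem_squareAddFactorTriples]

lemma sum_squareAddFactorTriples_swap (n : ℤ) (f : ℤ × ℤ × ℤ → ℤ) :
    ∑ t ∈ squareAddFactorTriples n, f (t.1, t.2.2, t.2.1) =
      ∑ t ∈ squareAddFactorTriples n, f t := by
  refine sum_nbij' (fun t => (t.1, t.2.2, t.2.1)) (fun t => (t.1, t.2.2, t.2.1)) ?_ ?_ ?_ ?_ ?_ <;>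
    simp +contextual [mem_squareAddFactorTriples, mul_comm]

/-- The sign `(-1) ^ (i + d + e)` attached to a triple `(i, d, e)`. -/
def tripleSign (t : ℤ × ℤ × ℤ) : ℤ := ((t.1 + t.2.1 + t.2.2).negOnePow : ℤˣ)

lemma negOnePow_congr {a b : ℤ} (h : Even (a - b)) : a.negOnePow = b.negOnePow :=
  (Int.negOnePow_eq_iff _ _).2 h

lemma tripleSign_congr {t u : ℤ × ℤ × ℤ}
    (h : Even (t.1 + t.2.1 + t.2.2 - (u.1 + u.2.1 + u.2.2))) : tripleSign t = tripleSign u :=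
  congrArg Units.val (negOnePow_congr h)

lemma sum_tripleSign_off_diagonal (n : ℤ) :
    ∑ t ∈ squareAddFactorTriples n with t.2.1 - t.2.2 ≠ 2 * t.1, tripleSign t *
      ((t.2.1 + t.2.2) * (t.2.1 - 2 * t.1) * (t.2.2 + 2 * t.1)) = 0 := by
  refine sum_involution
    (fun t _ => if 2 * t.1 < t.2.1 - t.2.2 then (-t.1 - t.2.2, t.2.1 - 2 * t.1 - t.2.2, t.2.2)
      else (t.2.1 - t.1, t.2.1, t.2.2 + 2 * t.1 - t.2.1)) ?_ ?_ ?_ ?_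
  · rintro ⟨i, d, e⟩ -
    dsimp only
    split_ifs
    · have h : tripleSign (-i - e, d - 2 * i - e, e) = tripleSign (i, d, e) :=
        tripleSign_congr ⟨-2 * i - e, by ring⟩
      rw [h]; ring
    · have h : tripleSign (d - i, d, e + 2 * i - d) = tripleSign (i, d, e) :=
        tripleSign_congr ⟨0, by ring⟩
      rw [h]; ring
  · rintro ⟨i, d, e⟩ - h
    contrapose! h
    dsimp only at h ⊢
    split_ifs at h <;> simp only [Prod.mk.injEq] at h
    · rw [show e + 2 * i = 0 by linarith]; ring
    · rw [show d - 2 * i = 0 by linarith]; ring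
  · rintro ⟨i, d, e⟩ h
    simp only [mem_filter, mem_squareAddFactorTriples] at h ⊢
    obtain ⟨⟨h1, h2, h3⟩, h4⟩ := h
    split_ifs <;> dsimp only
    · exact ⟨⟨by linarith, h2, by linarith⟩, by omega⟩
    · exact ⟨⟨h1, by omega, by linarith⟩, by omega⟩
  · rintro ⟨i, d, e⟩ h
    simp only [mem_filter, mem_squareAddFactorTriples] at h ⊢
    obtain ⟨⟨h1, h2, h3⟩, h4⟩ := h
    split_ifs <;> dsimp only at * <;> first | omega | (ext <;> dsimp only <;> ring)

lemma sum_alternating_mul_sub (k : ℕ) (c : ℤ) :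
    ∑ j ∈ range (2 * k + 1), (-1 : ℤ) ^ j * (j * (c - j)) = k * c - k * (2 * k + 1) := by
  induction k with
  | zero => simp
  | succ k ih =>
    rw [show 2 * (k + 1) + 1 = 2 * k + 1 + 1 + 1 by ring, sum_range_succ, sum_range_succ, ih]
    push_cast
    rw [show (-1 : ℤ) ^ (2 * k + 1 + 1) = 1 from Even.neg_one_pow ⟨k + 1, by ring⟩,
      show (-1 : ℤ) ^ (2 * k + 1) = -1 from Odd.neg_one_pow ⟨k, by ring⟩]
    ring

lemma sum_tripleSign_diagonal (k : ℕ) :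
    ∑ t ∈ squareAddFactorTriples ((k : ℤ) ^ 2) with t.2.1 - t.2.2 = 2 * t.1, tripleSign t *
      ((t.2.1 + t.2.2) * (t.2.1 - 2 * t.1) * (t.2.2 + 2 * t.1)) =
      -2 * (k : ℤ).negOnePow * k ^ 2 := by
  have h : ∑ j ∈ range (2 * k + 1), ((k : ℤ).negOnePow : ℤ) * (2 * k) *
      ((-1 : ℤ) ^ j * (j * ((2 * k : ℤ) - j))) = -2 * (k : ℤ).negOnePow * k ^ 2 := by
    rw [← mul_sum, sum_alternating_mul_sub]; ring
  rw [← h]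
  have hmem : ∀ t ∈ (squareAddFactorTriples ((k : ℤ) ^ 2)).filter
      (fun t => t.2.1 - t.2.2 = 2 * t.1),
      0 < t.2.1 ∧ 0 < t.2.2 ∧ t.1 = t.2.1 - k ∧ t.2.2 = 2 * k - t.2.1 := by
    rintro ⟨i, d, e⟩ ht
    simp only [mem_filter, mem_squareAddFactorTriples] at ht ⊢
    obtain ⟨⟨h1, h2, h3⟩, h4⟩ := ht
    have h5 : (d + e) ^ 2 = (2 * k : ℤ) ^ 2 := by
      linear_combination 4 * h3 + (d - e + 2 * i) * h4
    have h6 : d + e = 2 * k := (sq_eq_sq₀ (by omega) (by omega)).1 h5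
    omega
  refine sum_of_injOn (fun t => t.2.1.toNat) ?_ ?_ ?_ ?_
  · rintro ⟨i, d, e⟩ ht ⟨i', d', e'⟩ ht' hd
    have := hmem _ ht
    have := hmem _ ht'
    simp only [Prod.mk.injEq] at *
    omega
  · rintro ⟨i, d, e⟩ ht
    have := hmem _ ht
    simp only [coe_range, Set.mem_Iio] at *
    omega
  · intro j hj hj'
    rw [mem_range] at hj
    obtain rfl | rfl | hj0 : j = 0 ∨ j = 2 * k ∨ 0 < j ∧ j < 2 * k := by omega
    · simp
    · simp
    · refine absurd ⟨((j : ℤ) - k, (j : ℤ), (2 * k : ℤ) - j), ?_, by simp⟩ hj'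
      simp only [coe_filter, Set.mem_ofPred_eq, mem_squareAddFactorTriples]
      exact ⟨⟨by omega, by omega, by ring⟩, by ring⟩
  · rintro ⟨i, d, e⟩ ht
    obtain ⟨h1, h2, h3, h4⟩ := hmem _ ht
    dsimp only at h1 h2 h3 h4 ⊢
    lift d to ℕ using h1.le
    subst h3 h4
    have hs : tripleSign ((d : ℤ) - k, (d : ℤ), 2 * k - d) =
        ((k : ℤ).negOnePow : ℤ) * (-1) ^ d := by
      have : ((d : ℤ) - k + d + (2 * k - d)).negOnePow =
          (k : ℤ).negOnePow * (d : ℤ).negOnePow := by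
        rw [← Int.negOnePow_add]
        exact negOnePow_congr ⟨0, by ring⟩
      rw [tripleSign, this, Units.val_mul, Int.negOnePow_def (d : ℤ), zpow_natCast]
      simp
    rw [hs, Int.toNat_natCast]
    ring

lemma sum_tripleSign_eq_diagonal (n : ℤ) :
    2 * ∑ t ∈ squareAddFactorTriples n, tripleSign t * (t.2.1 * (n - 5 * t.1 ^ 2)) =
      ∑ t ∈ squareAddFactorTriples n with t.2.1 - t.2.2 = 2 * t.1, tripleSign t *
        ((t.2.1 + t.2.2) * (t.2.1 - 2 * t.1) * (t.2.2 + 2 * t.1)) := by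
  have hsplit := sum_filter_add_sum_filter_not (squareAddFactorTriples n)
    (fun t => t.2.1 - t.2.2 = 2 * t.1) fun t => tripleSign t *
        ((t.2.1 + t.2.2) * (t.2.1 - 2 * t.1) * (t.2.2 + 2 * t.1))
  rw [sum_tripleSign_off_diagonal, add_zero] at hsplit
  have hneg := sum_squareAddFactorTriples_neg n fun t =>
    tripleSign t * (2 * t.1 * (t.2.1 ^ 2 - t.2.2 ^ 2))
  have hswap := sum_squareAddFactorTriples_swap n fun t =>
    tripleSign t * (t.2.1 * (n - 5 * t.1 ^ 2))
  have hodd : ∑ t ∈ squareAddFactorTriples n,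
      tripleSign t * (2 * t.1 * (t.2.1 ^ 2 - t.2.2 ^ 2)) = 0 := by
    have : ∀ t : ℤ × ℤ × ℤ, tripleSign (-t.1, t.2) = tripleSign t := fun t =>
      tripleSign_congr ⟨-t.1, by ring⟩
    have h2 : ∀ t : ℤ × ℤ × ℤ, tripleSign t * (2 * -t.1 * (t.2.1 ^ 2 - t.2.2 ^ 2)) =
      -(tripleSign t * (2 * t.1 * (t.2.1 ^ 2 - t.2.2 ^ 2))) := fun t => by ring
    simp only [this, h2, sum_neg_distrib] at hneg
    linarith
  have hs : ∀ t : ℤ × ℤ × ℤ, tripleSign (t.1, t.2.2, t.2.1) = tripleSign t := fun t =>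
      tripleSign_congr ⟨0, by ring⟩
  simp only [hs] at hswap
  rw [hsplit, two_mul]
  nth_rewrite 1 [← hswap]
  rw [← add_zero (_ + _), ← hodd, ← sum_add_distrib, ← sum_add_distrib]
  refine sum_congr rfl fun t ht => ?_
  obtain ⟨-, -, h⟩ := mem_squareAddFactorTriples.1 ht
  rw [← h]
  ring

/-- The signed divisor sum `∑_{d * e = n} (-1) ^ ((d + 1) * (e + 1)) * d`. -/
noncomputable def signedDivisorSum (n : ℤ) : ℤ :=
  ∑ p ∈ factorPairs n, (((p.1 + 1) * (p.2 + 1)).negOnePow : ℤ) * p.1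

lemma sum_mul_signedDivisorSum (n : ℤ) :
    ∑ i ∈ Icc (-n) n, (n - 5 * i ^ 2) * signedDivisorSum (n - i ^ 2) =
      -(n.negOnePow : ℤ) * ∑ t ∈ squareAddFactorTriples n,
        tripleSign t * (t.2.1 * (n - 5 * t.1 ^ 2)) := by
  rw [sum_squareAddFactorTriples, mul_sum]
  refine sum_congr rfl fun i _ => ?_
  rw [signedDivisorSum, mul_sum, mul_sum]
  refine sum_congr rfl fun p hp => ?_
  obtain ⟨-, -, h⟩ := mem_factorPairs.1 hp
  have : (((p.1 + 1) * (p.2 + 1)).negOnePow : ℤ) = -(n.negOnePow : ℤ) * tripleSign (i, p) := by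
    have h1 : ((p.1 + 1) * (p.2 + 1)).negOnePow = (n + (i + p.1 + p.2) + 1).negOnePow := by
      refine negOnePow_congr ?_
      rw [show (p.1 + 1) * (p.2 + 1) - (n + (i + p.1 + p.2) + 1) = -(i * (i + 1)) by
        linear_combination h]
      exact (Int.even_mul_succ_self i).neg
    rw [h1, Int.negOnePow_succ, Int.negOnePow_add]
    simp [tripleSign]
  rw [this]
  ring

lemma sum_Icc_sq_eq (k : ℕ) (hk : 0 < k) (f : ℤ → ℤ) :
    ∑ i ∈ Icc (-(k : ℤ) ^ 2) ((k : ℤ) ^ 2), (if (k : ℤ) ^ 2 - i ^ 2 = 0 then f i else 0) =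
      f k + f (-k) := by
  have h : (Icc (-(k : ℤ) ^ 2) ((k : ℤ) ^ 2)).filter (fun i => (k : ℤ) ^ 2 - i ^ 2 = 0) =
      {(k : ℤ), -(k : ℤ)} := by
    ext i
    simp only [mem_filter, mem_Icc, mem_insert, mem_singleton, sub_eq_zero]
    rw [eq_comm (a := (k : ℤ) ^ 2), sq_eq_sq_iff_eq_or_eq_neg]
    have : (k : ℤ) ≤ k ^ 2 := Int.le_self_sq _
    constructor
    · exact fun h => h.2
    · rintro (rfl | rfl)
      · exact ⟨by omega, Or.inl rfl⟩
      · exact ⟨by omega, Or.inr rfl⟩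
  rw [← sum_filter, h, sum_pair (by omega)]

/-- The recurrence satisfied by `8 * signedDivisorSum`, extended by the value `1` at `0`. -/
lemma sum_mul_ite_add_signedDivisorSum (n : ℤ) (hn : 0 < n) :
    ∑ i ∈ Icc (-n) n, (n - 5 * i ^ 2) *
      ((if n - i ^ 2 = 0 then 1 else 0) + 8 * signedDivisorSum (n - i ^ 2)) = 0 := by
  have h1 := sum_mul_signedDivisorSum n
  have h2 := sum_tripleSign_eq_diagonal n
  simp only [mul_add, sum_add_distrib, mul_ite, mul_one, mul_zero, mul_left_comm _ (8 : ℤ)]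
  rw [← mul_sum, h1]
  by_cases hsq : ∃ k : ℕ, n = (k : ℤ) ^ 2
  · obtain ⟨k, rfl⟩ := hsq
    have hk : 0 < k := by
      rcases k.eq_zero_or_pos with rfl | h
      · simp at hn
      · exact h
    rw [sum_Icc_sq_eq k hk]
    rw [sum_tripleSign_diagonal] at h2
    have h3 : ((k : ℤ) ^ 2).negOnePow = (k : ℤ).negOnePow :=
      negOnePow_congr (by simpa [sq, mul_sub] using Int.even_mul_pred_self (k : ℤ))
    have h4 : ((k : ℤ).negOnePow : ℤ) * (k : ℤ).negOnePow = 1 := by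
      rw [← Units.val_mul, Int.units_mul_self, Units.val_one]
    rw [h3]
    linear_combination (-4 * ((k : ℤ).negOnePow : ℤ)) * h2 + 8 * (k : ℤ) ^ 2 * h4
  · push Not at hsq
    have h3 : ∀ i : ℤ, n ≠ i ^ 2 := fun i hi => hsq i.natAbs (by rw [hi, Int.natAbs_sq])
    have h4 : ∑ t ∈ squareAddFactorTriples n with t.2.1 - t.2.2 = 2 * t.1, tripleSign t *
        ((t.2.1 + t.2.2) * (t.2.1 - 2 * t.1) * (t.2.2 + 2 * t.1)) = 0 := by
      refine sum_eq_zero fun t ht => ?_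
      rw [mem_filter, mem_squareAddFactorTriples] at ht
      refine absurd ?_ (h3 (t.1 + t.2.2))
      linear_combination -ht.1.2.2 + t.2.2 * ht.2
    rw [h4] at h2
    have h5 : ∑ t ∈ squareAddFactorTriples n, tripleSign t * (t.2.1 * (n - 5 * t.1 ^ 2)) = 0 := by
      linarith
    simp [h5, sub_eq_zero, h3]

/-- The vectors in `ℤ ^ k` whose squared Euclidean norm is `n`. -/
noncomputable def sqSumVectors (k : ℕ) (n : ℤ) : Finset (Fin k → ℤ) :=
  (Fintype.piFinset fun _ => Icc (-n) n).filter fun x => ∑ i, x i ^ 2 = n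

lemma mem_sqSumVectors {k : ℕ} {n : ℤ} {x : Fin k → ℤ} :
    x ∈ sqSumVectors k n ↔ ∑ i, x i ^ 2 = n := by
  simp only [sqSumVectors, mem_filter, Fintype.mem_piFinset, mem_Icc, and_iff_right_iff_imp]
  rintro h i
  have h1 : x i ^ 2 ≤ n := h ▸ single_le_sum (f := fun j => x j ^ 2)
    (fun j _ => sq_nonneg (x j)) (mem_univ i)
  have h2 := Int.le_self_sq (x i)
  have h3 := Int.le_self_sq (-x i)
  constructor <;> nlinarith

lemma sum_sqSumVectors_succ (k : ℕ) (n : ℤ) (f : ℤ → ℤ) :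
    ∑ x ∈ sqSumVectors (k + 1) n, f (x 0) =
      ∑ i ∈ Icc (-n) n, f i * (sqSumVectors k (n - i ^ 2)).card := by
  have : ∀ i, f i * (sqSumVectors k (n - i ^ 2)).card =
      ∑ x ∈ sqSumVectors k (n - i ^ 2), f i := fun i => by simp [mul_comm]
  simp only [this]
  rw [sum_sigma']
  refine sum_nbij' (fun x => ⟨x 0, Fin.tail x⟩) (fun y => Fin.cons y.1 y.2) ?_ ?_ ?_ ?_ ?_
  · intro x hx
    have h := mem_sqSumVectors.1 hx
    simp only [sqSumVectors, mem_filter, Fintype.mem_piFinset] at hx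
    rw [mem_sigma, mem_sqSumVectors]
    rw [Fin.sum_univ_succ] at h
    exact ⟨hx.1 0, by rw [← h]; simp [Fin.tail]⟩
  · rintro ⟨i, x⟩ hx
    rw [mem_sigma, mem_sqSumVectors] at hx
    rw [mem_sqSumVectors, Fin.sum_univ_succ]
    simp [hx.2]
  · intro x _
    exact Fin.cons_self_tail x
  · rintro ⟨i, x⟩ _
    simp
  · intro x _
    rfl

/-- The recurrence satisfied by the number of representations as a sum of `k` squares. -/
lemma sum_mul_card_sqSumVectors (k : ℕ) (n : ℤ) :
    ∑ i ∈ Icc (-n) n, (n - (k + 1) * i ^ 2) * (sqSumVectors k (n - i ^ 2)).card = 0 := by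
  rw [← sum_sqSumVectors_succ k n fun i => n - (k + 1) * i ^ 2]
  have h : ∀ j : Fin (k + 1), ∑ x ∈ sqSumVectors (k + 1) n, x j ^ 2 =
      ∑ x ∈ sqSumVectors (k + 1) n, x 0 ^ 2 := fun j => by
    refine sum_nbij' (fun x => x ∘ Equiv.swap 0 j) (fun x => x ∘ Equiv.swap 0 j) ?_ ?_ ?_ ?_ ?_
    · intro x hx
      rw [mem_sqSumVectors] at hx ⊢
      rw [← hx]
      exact Equiv.sum_comp (Equiv.swap 0 j) fun i => x i ^ 2
    · intro x hx
      rw [mem_sqSumVectors] at hx ⊢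
      rw [← hx]
      exact Equiv.sum_comp (Equiv.swap 0 j) fun i => x i ^ 2
    · intro x _
      ext i; simp
    · intro x _
      ext i; simp
    · intro x _
      simp
  have h2 : ∑ x ∈ sqSumVectors (k + 1) n, n =
      (k + 1) * ∑ x ∈ sqSumVectors (k + 1) n, x 0 ^ 2 := by
    calc ∑ x ∈ sqSumVectors (k + 1) n, n
        = ∑ x ∈ sqSumVectors (k + 1) n, ∑ j, x j ^ 2 :=
          sum_congr rfl fun x hx => (mem_sqSumVectors.1 hx).symm
      _ = ∑ j, ∑ x ∈ sqSumVectors (k + 1) n, x j ^ 2 := sum_comm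
      _ = _ := by simp [h]
  rw [sum_sub_distrib, h2, ← mul_sum, sub_self]

/-- A function on the integers is determined by its values at nonpositive integers together with
the recurrence `∑ i, (n - 5 * i ^ 2) * F (n - i ^ 2) = 0`. -/
lemma eq_of_sum_mul_sub_sq {F G : ℤ → ℤ} (h0 : ∀ n ≤ 0, F n = G n)
    (hF : ∀ n, 0 < n → ∑ i ∈ Icc (-n) n, (n - 5 * i ^ 2) * F (n - i ^ 2) = 0)
    (hG : ∀ n, 0 < n → ∑ i ∈ Icc (-n) n, (n - 5 * i ^ 2) * G (n - i ^ 2) = 0) (n : ℤ) :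
    F n = G n := by
  suffices h : ∀ m : ℕ, ∀ n : ℤ, n ≤ m → F n = G n from h n.toNat n (Int.self_le_toNat n)
  intro m
  induction m with
  | zero => exact fun n hn => h0 n (by simpa using hn)
  | succ m ih =>
    intro n hn
    rcases le_or_gt n 0 with hn0 | hn0
    · exact h0 n hn0
    have hmem : (0 : ℤ) ∈ Icc (-n) n := by rw [mem_Icc]; omega
    have h1 := hF n hn0
    have h2 := hG n hn0
    rw [← add_sum_erase _ _ hmem] at h1 h2
    have h3 : ∑ i ∈ (Icc (-n) n).erase 0, (n - 5 * i ^ 2) * F (n - i ^ 2) =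
        ∑ i ∈ (Icc (-n) n).erase 0, (n - 5 * i ^ 2) * G (n - i ^ 2) := by
      refine sum_congr rfl fun i hi => ?_
      have : 0 < i ^ 2 := by have := (mem_erase.1 hi).1; positivity
      rw [ih _ (by push_cast at hn; omega)]
    rw [h3] at h1
    have h4 : n * F n = n * G n := by
      simp only [ne_eq, OfNat.ofNat_ne_zero, not_false_eq_true, zero_pow, mul_zero,
        sub_zero] at h1 h2
      linarith
    exact mul_left_cancel₀ hn0.ne' h4

/-- **Jacobi's four-square theorem**, with a signed divisor sum. -/
theorem card_sqSumVectors_four {n : ℤ} (hn : 0 < n) :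
    ((sqSumVectors 4 n).card : ℤ) = 8 * signedDivisorSum n := by
  have hempty : ∀ m ≤ 0, factorPairs m = ∅ := fun m hm => by
    rw [factorPairs, Icc_eq_empty (by omega)]; simp
  have := eq_of_sum_mul_sub_sq (F := fun n => (sqSumVectors 4 n).card)
    (G := fun n => (if n = 0 then 1 else 0) + 8 * signedDivisorSum n) ?_
    (fun n _ => by simpa using sum_mul_card_sqSumVectors 4 n)
    sum_mul_ite_add_signedDivisorSum n
  · simpa [hn.ne'] using this
  · intro m hm
    simp only [signedDivisorSum, hempty m hm, sum_empty, mul_zero, add_zero]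
    rcases hm.lt_or_eq with h | rfl
    · rw [if_neg h.ne, Nat.cast_eq_zero, card_eq_zero, eq_empty_iff_forall_notMem]
      intro x hx
      rw [mem_sqSumVectors] at hx
      have : 0 ≤ ∑ i, x i ^ 2 := sum_nonneg fun i _ => sq_nonneg (x i)
      omega
    · rw [if_pos rfl, Nat.cast_eq_one, card_eq_one]
      refine ⟨0, ?_⟩
      ext x
      rw [mem_sqSumVectors, mem_singleton,
        sum_eq_zero_iff_of_nonneg fun i _ => sq_nonneg (x i)]
      simp [funext_iff]

lemma signedDivisorSum_natCast (n : ℕ) :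
    signedDivisorSum n = ∑ p ∈ n.divisorsAntidiagonal,
      ((((p.1 : ℤ) + 1) * (p.2 + 1)).negOnePow : ℤ) * p.1 := by
  symm
  refine sum_nbij' (fun p => ((p.1 : ℤ), (p.2 : ℤ))) (fun p => (p.1.toNat, p.2.toNat))
    ?_ ?_ ?_ ?_ ?_
  · rintro ⟨a, b⟩ h
    obtain ⟨rfl, h⟩ := Nat.mem_divisorsAntidiagonal.1 h
    rw [mem_factorPairs]
    exact ⟨Int.natCast_pos.2 (Nat.pos_of_ne_zero (left_ne_zero_of_mul h)),
      Int.natCast_pos.2 (Nat.pos_of_ne_zero (right_ne_zero_of_mul h)), by simp⟩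
  · rintro ⟨a, b⟩ h
    obtain ⟨ha, hb, h⟩ := mem_factorPairs.1 h
    dsimp only at ha hb h ⊢
    lift a to ℕ using ha.le
    lift b to ℕ using hb.le
    norm_cast at ha hb h
    rw [Nat.mem_divisorsAntidiagonal]
    exact ⟨by simpa using h, by rw [← h]; positivity⟩
  · simp
  · rintro ⟨a, b⟩ h
    obtain ⟨ha, hb, h⟩ := mem_factorPairs.1 h
    simp [ha.le, hb.le]
  · simp

lemma summable_pnat_rpow_neg {s : ℝ} (hs : 1 < s) : Summable fun n : ℕ+ => (n : ℝ) ^ (-s) :=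
  (Real.summable_nat_rpow.2 (by linarith : -s < -1)).comp_injective PNat.coe_injective

lemma hasSum_rpow_mul_rpow {s : ℝ} (hs : 2 < s) :
    HasSum (fun p : ℕ+ × ℕ+ => (p.1 : ℝ) ^ (-(s - 1)) * (p.2 : ℝ) ^ (-s))
      (rzeta (s - 1) * rzeta s) := by
  have h1 := summable_pnat_rpow_neg (by linarith : 1 < s - 1)
  have h2 := summable_pnat_rpow_neg (by linarith : 1 < s)
  exact h1.hasSum.mul h2.hasSum
    (h1.mul_of_nonneg h2 (fun n => by dsimp; positivity) (fun n => by dsimp; positivity))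

lemma hasSum_sign_mul_rpow_mul_rpow {s : ℝ} (hs : 2 < s) :
    HasSum (fun p : ℕ+ × ℕ+ => (((((p.1 : ℤ) + 1) * (p.2 + 1)).negOnePow : ℤ) : ℝ) *
        ((p.1 : ℝ) ^ (-(s - 1)) * (p.2 : ℝ) ^ (-s)))
      ((1 - (4 : ℝ) ^ (1 - s)) * rzeta s * rzeta (s - 1)) := by
  have h := hasSum_rpow_mul_rpow hs
  have hinj : Function.Injective fun p : ℕ+ × ℕ+ => (2 * p.1, 2 * p.2) := by
    rintro ⟨a, b⟩ ⟨c, d⟩ h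
    simpa using h
  have heven : HasSum (fun p : ℕ+ × ℕ+ => if Even (p.1 : ℕ) ∧ Even (p.2 : ℕ) then
      (p.1 : ℝ) ^ (-(s - 1)) * (p.2 : ℝ) ^ (-s) else 0)
      (2 ^ (-(s - 1)) * 2 ^ (-s) * (rzeta (s - 1) * rzeta s)) := by
    rw [← hinj.hasSum_iff]
    · refine (h.mul_left _).congr_fun ?_
      intro p
      simp [Real.mul_rpow]
      ring
    · rintro ⟨a, b⟩ hp
      refine if_neg fun ⟨ha, hb⟩ => hp ?_
      obtain ⟨c, hc⟩ := even_iff_two_dvd.1 ha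
      obtain ⟨d, hd⟩ := even_iff_two_dvd.1 hb
      have := a.pos
      have := b.pos
      dsimp only at hc hd
      exact ⟨(⟨c, by omega⟩, ⟨d, by omega⟩),
        Prod.ext (PNat.eq hc.symm) (PNat.eq hd.symm)⟩
  have hfour : (4 : ℝ) ^ (1 - s) = 2 * (2 ^ (-(s - 1)) * 2 ^ (-s)) := by
    rw [← Real.rpow_add two_pos, ← Real.rpow_one_add' two_pos.le (by linarith),
      show (4 : ℝ) = 2 ^ (2 : ℝ) by norm_num, ← Real.rpow_mul two_pos.le]
    ring_nf
  rw [show (1 - (4 : ℝ) ^ (1 - s)) * rzeta s * rzeta (s - 1) = rzeta (s - 1) * rzeta s -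
    2 * (2 ^ (-(s - 1)) * 2 ^ (-s) * (rzeta (s - 1) * rzeta s)) by rw [hfour]; ring]
  refine (h.sub (heven.mul_left 2)).congr_fun fun p => ?_
  split_ifs with hp
  · have : Odd (((p.1 : ℤ) + 1) * (p.2 + 1)) := by
      have h1 : Even (p.1 : ℤ) := by exact_mod_cast hp.1
      have h2 : Even (p.2 : ℤ) := by exact_mod_cast hp.2
      exact h1.add_one.mul h2.add_one
    rw [Int.negOnePow_odd _ this]
    push_cast
    ring
  · have : Even (((p.1 : ℤ) + 1) * (p.2 + 1)) := by
      have : Even ((p.1 + 1 : ℕ) * (p.2 + 1 : ℕ)) := by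
        simp only [Nat.even_mul, Nat.even_add_one]
        tauto
      exact_mod_cast this
    rw [Int.negOnePow_even _ this]
    simp

lemma hasSum_signedDivisorSum_mul_rpow {s : ℝ} (hs : 2 < s) :
    HasSum (fun n : ℕ+ => (signedDivisorSum n : ℝ) * (n : ℝ) ^ (-s))
      ((1 - (4 : ℝ) ^ (1 - s)) * rzeta s * rzeta (s - 1)) := by
  refine (sigmaAntidiagonalEquivProd.hasSum_iff.2 (hasSum_sign_mul_rpow_mul_rpow hs)).sigma
    fun n => ?_
  have : (signedDivisorSum n : ℝ) * (n : ℝ) ^ (-s) =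
      ∑ p ∈ (n : ℕ).divisorsAntidiagonal, (((((p.1 : ℤ) + 1) * (p.2 + 1)).negOnePow : ℤ) : ℝ) *
        ((p.1 : ℝ) ^ (-(s - 1)) * (p.2 : ℝ) ^ (-s)) := by
    rw [signedDivisorSum_natCast, Int.cast_sum, sum_mul]
    refine sum_congr rfl fun p hp => ?_
    obtain ⟨h1, h2⟩ := Nat.mem_divisorsAntidiagonal.1 hp
    have hp1 : (0 : ℝ) < p.1 := by
      exact_mod_cast Nat.pos_of_ne_zero fun h => h2 (by rw [← h1, h, zero_mul])
    rw [← h1, show -(s - 1) = 1 + -s by ring, Real.rpow_add hp1, Real.rpow_one]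
    push_cast
    rw [Real.mul_rpow (by positivity) (by positivity)]
    ring
  rw [this]
  exact (n : ℕ).divisorsAntidiagonal.hasSum _

/-- The nonzero vectors of `ℤ ^ 4`, sorted by their squared norm. -/
noncomputable def sigmaSqSumVectorsEquiv :
    (Σ n : ℕ+, sqSumVectors 4 (n : ℤ)) ≃ {x : Fin 4 → ℤ // x ≠ 0} :=
  Equiv.ofBijective
    (fun x => ⟨x.2, fun h => by
      have h1 := mem_sqSumVectors.1 x.2.2
      have := x.1.pos
      simp only [h, Pi.zero_apply] at h1
      simp at h1
      omega⟩) <| by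
    constructor
    · rintro ⟨n, x, hx⟩ ⟨m, y, hy⟩ h
      obtain rfl : x = y := congrArg Subtype.val h
      obtain rfl : n = m := by
        rw [mem_sqSumVectors] at hx hy
        exact PNat.eq (by exact_mod_cast hx.symm.trans hy)
      rfl
    · rintro ⟨x, hx⟩
      have hpos : 0 < ∑ i, x i ^ 2 := by
        obtain ⟨i, hi⟩ := Function.ne_iff.1 hx
        exact sum_pos' (fun j _ => sq_nonneg (x j)) ⟨i, mem_univ i, by
          have : x i ≠ 0 := hi
          positivity⟩
      refine ⟨⟨⟨(∑ i, x i ^ 2).toNat, by omega⟩, x, ?_⟩, rfl⟩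
      rw [mem_sqSumVectors]
      simp [hpos.le]

lemma hasSum_epstein_zeta_Z4 {s : ℝ} (hs : 2 < s) :
    HasSum (fun x : {x : Fin 4 → ℤ // x ≠ 0} => (∑ i, ((x.1 i : ℝ)) ^ 2) ^ (-s))
      (8 * (1 - (4 : ℝ) ^ (1 - s)) * rzeta s * rzeta (s - 1)) := by
  rw [← sigmaSqSumVectorsEquiv.hasSum_iff]
  have hval : ∀ (n : ℕ+) (x : sqSumVectors 4 (n : ℤ)),
      ((fun x : {x : Fin 4 → ℤ // x ≠ 0} => (∑ i, ((x.1 i : ℝ)) ^ 2) ^ (-s)) ∘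
        sigmaSqSumVectorsEquiv) ⟨n, x⟩ = (n : ℝ) ^ (-s) := fun n x => by
    have h := mem_sqSumVectors.1 x.2
    have h2 : ∑ i, ((x.1 i : ℝ)) ^ 2 = n := by exact_mod_cast h
    exact congrArg (· ^ (-s)) h2
  have hfiber : ∀ n : ℕ+, HasSum (fun x : sqSumVectors 4 (n : ℤ) =>
      ((fun x : {x : Fin 4 → ℤ // x ≠ 0} => (∑ i, ((x.1 i : ℝ)) ^ 2) ^ (-s)) ∘
        sigmaSqSumVectorsEquiv) ⟨n, x⟩) (8 * ((signedDivisorSum n : ℝ) * (n : ℝ) ^ (-s))) := by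
    intro n
    have hcard : ((sqSumVectors 4 (n : ℤ)).card : ℝ) = 8 * signedDivisorSum n := by
      exact_mod_cast card_sqSumVectors_four (n := n) (by exact_mod_cast n.pos)
    simp only [hval]
    have := hasSum_fintype fun _ : sqSumVectors 4 (n : ℤ) => (n : ℝ) ^ (-s)
    rwa [sum_const, card_univ, Fintype.card_coe, nsmul_eq_mul, hcard, mul_assoc] at this
  have htotal := (hasSum_signedDivisorSum_mul_rpow hs).mul_left 8
  rw [show 8 * (1 - (4 : ℝ) ^ (1 - s)) * rzeta s * rzeta (s - 1) =
    8 * ((1 - (4 : ℝ) ^ (1 - s)) * rzeta s * rzeta (s - 1)) by ring]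
  refine htotal.sigma_of_hasSum hfiber ((summable_sigma_of_nonneg ?_).2 ⟨?_, ?_⟩)
  · intro x
    exact Real.rpow_nonneg (sum_nonneg fun i _ => sq_nonneg _) _
  · exact fun n => (hfiber n).summable
  · simp only [(hfiber _).tsum_eq]
    exact htotal.summable

end

/-- For every real number `s > 2`, the Epstein zeta function of the lattice `ℤ⁴`
(i.e. `∑_{x ∈ ℤ⁴ \ {0}} ‖x‖^{-2s} = ∑_{x ≠ 0} (‖x‖²)^{-s}`) converges and satisfies
`ζ_{ℤ⁴}(s) = 8 (1 - 4^{1-s}) ζ(s) ζ(s-1)`. -/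
theorem epstein_zeta_Z4 (s : ℝ) (hs : 2 < s) :
    Summable (fun x : {x : Fin 4 → ℤ // x ≠ 0} => (∑ i, ((x.1 i : ℝ)) ^ 2) ^ (-s)) ∧
    ∑' x : {x : Fin 4 → ℤ // x ≠ 0}, (∑ i, ((x.1 i : ℝ)) ^ 2) ^ (-s)
      = 8 * (1 - (4 : ℝ) ^ (1 - s)) * rzeta s * rzeta (s - 1) := by
  exact ⟨(hasSum_epstein_zeta_Z4 hs).summable, (hasSum_epstein_zeta_Z4 hs).tsum_eq⟩
end

section
/- For every real number s > 2, the Epstein zeta function of the checkerboard lattice D₄ satisfies ζ_{D₄}(s) = 3·4^{2−s}·(2^{s−1} − 1)·ζ(s)·ζ(s−1), where ζ is the Riemann zeta function. -/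
open scoped BigOperators

section

open UpperHalfPlane hiding I
open Complex ModularGroup Matrix.SpecialLinearGroup ModularForm EisensteinSeries
open Function.Periodic (qParam)
open scoped Real MatrixGroups Manifold ModularForm ArithmeticFunction.sigma

theorem levelOne_weight_six_eq_zero {f : ℍ → ℂ} (hf : MDiff f) (hS : f ∣[(6 : ℤ)] S = f)
    (hT : f ∣[(6 : ℤ)] T = f) (h0 : IsZeroAtImInfty f) : f = 0 := by
  have hinv := SlashInvariantForm.slash_action_generators_SL2Z hS hT
  let F : CuspForm 𝒮ℒ 6 :=
    { toFun := f
      slash_action_eq' := fun _ ⟨γ, hγ⟩ ↦ hγ ▸ hinv γ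
      holo' := hf
      zero_at_cusps' := fun {c} hc ↦ by
        rw [OnePoint.isZeroAt_iff_forall_SL2Z hc]
        intro γ _
        rwa [hinv γ] }
  have hF : F = 0 := rank_zero_iff_forall_zero.mp
    (CuspForm.rank_eq_zero_of_weight_lt_twelve (by norm_num)) F
  exact congrArg (fun g : CuspForm 𝒮ℒ 6 ↦ (g : ℍ → ℂ)) hF

theorem eq_zero_or_eq_zero_of_mdifferentiable_of_mul_eq_zero {f g : ℍ → ℂ} (hf : MDiff f)
    (hg : MDiff g) (hfg : f * g = 0) : f = 0 ∨ g = 0 := by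
  have hopen : IsOpen {z : ℂ | 0 < z.im} := isOpen_lt continuous_const continuous_im
  have hconn : IsPreconnected {z : ℂ | 0 < z.im} := (convex_halfSpace_im_gt 0).isPreconnected
  have key (u : ℍ → ℂ) (hu : ∀ z ∈ {z : ℂ | 0 < z.im}, (u ∘ ofComplex) z = 0) : u = 0 := by
    ext τ
    simpa using hu τ τ.im_pos
  refine (AnalyticOnNhd.eq_zero_or_eq_zero_of_mul_eq_zero
    ((UpperHalfPlane.mdifferentiable_iff.mp hf).analyticOnNhd hopen)
    ((UpperHalfPlane.mdifferentiable_iff.mp hg).analyticOnNhd hopen) (fun z _ ↦ ?_) hconn).imp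
    (key f) (key g)
  simpa using congrFun hfg (ofComplex z)

/-- A weight two form for `Γ₀(2)` vanishing at the cusp `∞` is zero: its norm to level one is a
cusp form of weight six. -/
theorem eq_zero_of_weight_two_level_two {f : ℍ → ℂ} (hf : MDiff f) (hT : f ∣[(2 : ℤ)] T = f)
    (hST : ((f ∣[(2 : ℤ)] S) ∣[(2 : ℤ)] T) ∣[(2 : ℤ)] T = f ∣[(2 : ℤ)] S) (h0 : IsZeroAtImInfty f)
    (hbdd : IsBoundedAtImInfty (f ∣[(2 : ℤ)] S)) : f = 0 := by
  set g := f ∣[(2 : ℤ)] S with hg_def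
  set h := g ∣[(2 : ℤ)] T with hh_def
  have hg : MDiff g := hf.slash 2 _
  have hh : MDiff h := hg.slash 2 _
  have hhT : h ∣[(2 : ℤ)] T = g := hST
  have hgT' : g ∣[(2 : ℤ)] T⁻¹ = h := by
    rw [← hhT, ← SlashAction.slash_mul, mul_inv_cancel, SlashAction.slash_one]
  have hfT' : f ∣[(2 : ℤ)] T⁻¹ = f := by
    conv_lhs => rw [← hT]
    rw [← SlashAction.slash_mul, mul_inv_cancel, SlashAction.slash_one]
  have hgS : g ∣[(2 : ℤ)] S = f := by
    rw [hg_def, ← SlashAction.slash_mul, show S * S = -1 by decide]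
    ext z
    simp [SL_slash_apply, denom]
  have hhS : h ∣[(2 : ℤ)] S = h := by
    have hrel : S * T * S = T⁻¹ * S * T⁻¹ := by decide
    rw [hh_def, hg_def, ← SlashAction.slash_mul, ← SlashAction.slash_mul, ← mul_assoc, hrel,
      SlashAction.slash_mul, SlashAction.slash_mul, hfT', ← hg_def, hgT', hh_def]
  have hhb : IsBoundedAtImInfty h := by
    rw [hh_def, SL_slash]
    exact IsBoundedAtImInfty.slash _ (by simp [coe_T]) hbdd
  have hprod : f * g * h = 0 := by
    refine levelOne_weight_six_eq_zero ((hf.mul hg).mul hh) ?_ ?_ ?_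
    · rw [show (6 : ℤ) = 2 + 2 + 2 by norm_num, mul_slash_SL2, mul_slash_SL2, hgS, hhS, ← hg_def,
        mul_comm g f]
    · rw [show (6 : ℤ) = 2 + 2 + 2 by norm_num, mul_slash_SL2, mul_slash_SL2, hT, hhT, ← hh_def,
        mul_right_comm]
    · rw [mul_assoc]
      exact Filter.ZeroAtFilter.mul_boundedAtFilter h0 (Filter.BoundedAtFilter.mul hbdd hhb)
  have hf0 (hg0 : g = 0) : f = 0 := by rw [← hgS, hg0, SlashAction.zero_slash]
  rcases eq_zero_or_eq_zero_of_mdifferentiable_of_mul_eq_zero (hf.mul hg) hh hprod with h1 | h1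
  · exact (eq_zero_or_eq_zero_of_mdifferentiable_of_mul_eq_zero hf hg h1).elim id hf0
  · exact hf0 (by rw [← hhT, h1, SlashAction.zero_slash])

theorem slash_two_S_apply (f : ℍ → ℂ) (τ : ℍ) :
    (f ∣[(2 : ℤ)] S) τ = f (S • τ) / (τ : ℂ) ^ 2 := by
  rw [SL_slash_apply, denom_S, zpow_neg, div_eq_mul_inv]
  rfl

theorem slash_two_T_apply (f : ℍ → ℂ) (τ : ℍ) : (f ∣[(2 : ℤ)] T) τ = f ((1 : ℝ) +ᵥ τ) := by
  rw [SL_slash_apply, modular_T_smul, ModularGroup.denom_apply]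
  simp [T]

/-! ### Theta functions -/

theorem jacobiTheta₂_add_one_right (z τ : ℂ) :
    jacobiTheta₂ z (τ + 1) = jacobiTheta₂ (z + 1 / 2) τ := by
  refine tsum_congr fun n ↦ ?_
  obtain ⟨k, hk⟩ := Int.even_mul_succ_self n
  have hsq : (n : ℂ) ^ 2 = 2 * k - n := by
    have : (n : ℂ) * (n + 1) = k + k := mod_cast hk
    linear_combination this
  rw [jacobiTheta₂_term, jacobiTheta₂_term, Complex.exp_eq_exp_iff_exists_int]
  refine ⟨k - n, ?_⟩
  push_cast
  linear_combination (π * I : ℂ) * hsq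

/-- The theta series `∑ₙ exp (π i (n + z)² τ)` of a translate of `ℤ`. -/
noncomputable def shiftedTheta (z τ : ℂ) : ℂ :=
  cexp (π * I * z ^ 2 * τ) * jacobiTheta₂ (z * τ) τ

theorem jacobiTheta₂_S_smul_pow_four (z : ℂ) (τ : ℍ) :
    jacobiTheta₂ z ↑(S • τ) ^ 4 = -(τ : ℂ) ^ 2 * shiftedTheta z τ ^ 4 := by
  have hτ : (τ : ℂ) ≠ 0 := ne_zero τ
  have hI : -I * (τ : ℂ) ≠ 0 := by simp [hτ]
  have hpow : ((-I * (τ : ℂ)) ^ (1 / 2 : ℂ)) ^ 4 = -(τ : ℂ) ^ 2 := by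
    rw [← cpow_nat_mul, show ((4 : ℕ) : ℂ) * (1 / 2) = (2 : ℕ) by norm_num, cpow_natCast]
    linear_combination (τ : ℂ) ^ 2 * I_sq
  have hne : (-I * (τ : ℂ)) ^ (1 / 2 : ℂ) ≠ 0 := by simp [cpow_eq_zero_iff, hτ]
  have hfe := jacobiTheta₂_functional_equation (z * τ) τ
  have harg : (-π * I * (z * τ) ^ 2 / τ : ℂ) = -(π * I * z ^ 2 * τ) := by field_simp
  rw [harg, mul_div_cancel_right₀ _ hτ, Complex.exp_neg] at hfe
  have hS : ((S • τ : ℍ) : ℂ) = -1 / τ := by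
    rw [modular_S_smul]
    simp [div_eq_mul_inv, inv_neg]
  have key : jacobiTheta₂ z (-1 / τ) = (-I * (τ : ℂ)) ^ (1 / 2 : ℂ) * shiftedTheta z τ := by
    rw [shiftedTheta, hfe]
    field_simp [Complex.exp_ne_zero]
  rw [hS, key, mul_pow, hpow]

theorem shiftedTheta_add_two (z τ : ℂ) (k : ℤ) (hz : 2 * z = k) :
    shiftedTheta z (τ + 2) ^ 4 = shiftedTheta z τ ^ 4 := by
  have hper : jacobiTheta₂ (z * τ + k) τ = jacobiTheta₂ (z * τ) τ :=
    tsum_congr fun n ↦ by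
      rw [jacobiTheta₂_term, jacobiTheta₂_term, Complex.exp_eq_exp_iff_exists_int]
      exact ⟨n * k, by push_cast; ring⟩
  have hexp : cexp (π * I * z ^ 2 * 2) ^ 4 = 1 := by
    rw [← Complex.exp_nat_mul, Complex.exp_eq_one_iff]
    exact ⟨k ^ 2, by push_cast; rw [← hz]; ring⟩
  rw [shiftedTheta, mul_add z, mul_comm z 2, hz, jacobiTheta₂_add_right, hper, mul_add,
    Complex.exp_add, shiftedTheta]
  linear_combination (cexp (π * I * z ^ 2 * τ) * jacobiTheta₂ (z * τ) τ) ^ 4 * hexp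

theorem isBoundedAtImInfty_shiftedTheta (z : ℝ) :
    IsBoundedAtImInfty fun τ : ℍ ↦ shiftedTheta z τ := by
  have hterm (n : ℤ) (τ : ℍ) : ‖cexp (π * I * z ^ 2 * τ) * jacobiTheta₂_term n (z * τ) τ‖
      = rexp (-π * (n + z) ^ 2 * τ.im) := by
    rw [norm_mul, norm_jacobiTheta₂_term, Complex.norm_exp, ← Real.exp_add]
    congr 1
    have : (π * I * z ^ 2 * τ : ℂ) = ((π * z ^ 2 : ℝ) : ℂ) * (I * τ) := by push_cast; ring
    rw [this, re_ofReal_mul, im_ofReal_mul, coe_im]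
    simp
    ring
  have hsum : Summable fun n : ℤ ↦ rexp (-π * (n + z) ^ 2) := by
    have := (((summable_jacobiTheta₂_term_iff (z * (UpperHalfPlane.I : ℍ))
      (UpperHalfPlane.I : ℍ)).mpr UpperHalfPlane.I.im_pos).mul_left
        (cexp (π * I * z ^ 2 * (UpperHalfPlane.I : ℍ)))).norm
    refine this.congr fun n ↦ ?_
    rw [hterm]
    simp
  rw [isBoundedAtImInfty_iff]
  refine ⟨∑' n : ℤ, rexp (-π * (n + z) ^ 2), 1, fun τ hτ ↦ ?_⟩
  rw [shiftedTheta, jacobiTheta₂, ← tsum_mul_left]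
  refine tsum_of_norm_bounded hsum.hasSum fun n ↦ ?_
  rw [hterm, Real.exp_le_exp]
  have : 0 ≤ π * (n + z) ^ 2 := by positivity
  nlinarith

theorem mdifferentiable_jacobiTheta₂ (z : ℂ) : MDiff fun τ : ℍ ↦ jacobiTheta₂ z τ := by
  rw [UpperHalfPlane.mdifferentiable_iff]
  refine DifferentiableOn.congr (f := jacobiTheta₂ z) (fun τ hτ ↦
    (differentiableAt_jacobiTheta₂_snd z hτ).differentiableWithinAt) fun τ hτ ↦ ?_
  simp [ofComplex_apply_of_im_pos hτ]

/-! ### The weight two Eisenstein series of level two -/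

/-- The positive real number `2`, acting on the upper half plane. -/
abbrev posTwo : {x : ℝ // 0 < x} := ⟨2, two_pos⟩

/-- The positive real number `1 / 2`, acting on the upper half plane. -/
noncomputable abbrev posHalf : {x : ℝ // 0 < x} := ⟨1 / 2, one_half_pos⟩

theorem E2_one_vadd (τ : ℍ) : E2 ((1 : ℝ) +ᵥ τ) = E2 τ := by
  rw [← slash_two_T_apply E2, E2_slash_action, D2_T]
  simp

theorem E2_S_smul (τ : ℍ) :
    E2 (S • τ) = (τ : ℂ) ^ 2 * (E2 τ - 1 / (2 * riemannZeta 2) * (2 * π * I / τ)) := by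
  have h := congrFun (E2_slash_action S) τ
  rw [slash_two_S_apply, div_eq_iff (pow_ne_zero 2 (ne_zero τ))] at h
  rw [h, mul_comm]
  simp [D2_S]

theorem tendsto_pos_real_smul_atImInfty (a : {x : ℝ // 0 < x}) :
    Filter.Tendsto (fun τ : ℍ ↦ a • τ) atImInfty atImInfty := by
  rw [atImInfty, Filter.tendsto_comap_iff]
  refine (Filter.tendsto_comap.const_mul_atTop a.2).congr fun τ ↦ ?_
  simp

theorem MDifferentiable.comp_pos_real_smul {f : ℍ → ℂ} (hf : MDiff f) (a : {x : ℝ // 0 < x}) :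
    MDiff fun τ : ℍ ↦ f (a • τ) := by
  rw [UpperHalfPlane.mdifferentiable_iff] at hf ⊢
  have hmaps : Set.MapsTo (fun z : ℂ ↦ (a : ℝ) * z) {z : ℂ | 0 < z.im} {z : ℂ | 0 < z.im} :=
    fun z hz ↦ by simpa using mul_pos a.2 hz
  refine (hf.comp (by fun_prop) hmaps).congr fun z hz ↦ ?_
  have hz' := hmaps hz
  simp only [Function.comp_apply, ofComplex_apply_of_im_pos hz, ofComplex_apply_of_im_pos hz']
  congr 1

/-- The Eisenstein series `2 E₂(2τ) - E₂(τ)` of weight two and level two. -/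
noncomputable def eisensteinLevelTwo (τ : ℍ) : ℂ := 2 * E2 (posTwo • τ) - E2 τ

theorem eisensteinLevelTwo_one_vadd (τ : ℍ) :
    eisensteinLevelTwo ((1 : ℝ) +ᵥ τ) = eisensteinLevelTwo τ := by
  have h : posTwo • ((1 : ℝ) +ᵥ τ) = (1 : ℝ) +ᵥ ((1 : ℝ) +ᵥ posTwo • τ) := by
    ext
    simp
    ring
  rw [eisensteinLevelTwo, h, E2_one_vadd, E2_one_vadd, E2_one_vadd, eisensteinLevelTwo]

theorem eisensteinLevelTwo_S_smul (τ : ℍ) :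
    eisensteinLevelTwo (S • τ) = (τ : ℂ) ^ 2 * (E2 (posHalf • τ) / 2 - E2 τ) := by
  have h : posTwo • (S • τ) = S • (posHalf • τ) := by
    ext
    rw [modular_S_smul, modular_S_smul]
    simp [mul_comm]
  have hτ : (τ : ℂ) ≠ 0 := ne_zero τ
  rw [eisensteinLevelTwo, h, E2_S_smul, E2_S_smul]
  simp only [coe_pos_real_smul, real_smul]
  push_cast
  field_simp
  ring

/-! ### The theta series of the lattice -/

/-- The theta series of `D₄`, as a function on the upper half plane. -/
noncomputable def thetaD4 (τ : ℍ) : ℂ := (jacobiTheta₂ 0 τ ^ 4 + jacobiTheta₂ (1 / 2) τ ^ 4) / 2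

theorem thetaD4_one_vadd (τ : ℍ) : thetaD4 ((1 : ℝ) +ᵥ τ) = thetaD4 τ := by
  have h (z : ℂ) : jacobiTheta₂ z ↑((1 : ℝ) +ᵥ τ) = jacobiTheta₂ (z + 1 / 2) τ := by
    rw [coe_vadd, ofReal_one, add_comm, jacobiTheta₂_add_one_right]
  rw [thetaD4, h, h, add_halves, zero_add, ← zero_add (1 : ℂ), jacobiTheta₂_add_left, thetaD4,
    zero_add, add_comm]

theorem thetaD4_S_smul (τ : ℍ) :
    thetaD4 (S • τ) = -(τ : ℂ) ^ 2 * (shiftedTheta 0 τ ^ 4 + shiftedTheta (1 / 2) τ ^ 4) / 2 := by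
  rw [thetaD4, jacobiTheta₂_S_smul_pow_four, jacobiTheta₂_S_smul_pow_four]
  ring

theorem mdifferentiable_thetaD4_sub_eisensteinLevelTwo : MDiff (thetaD4 - eisensteinLevelTwo) := by
  have hθ (z : ℂ) := UpperHalfPlane.mdifferentiable_iff.mp (mdifferentiable_jacobiTheta₂ z)
  have hE := UpperHalfPlane.mdifferentiable_iff.mp E2_mdifferentiable
  have hE' := UpperHalfPlane.mdifferentiable_iff.mp
    (MDifferentiable.comp_pos_real_smul E2_mdifferentiable posTwo)
  rw [UpperHalfPlane.mdifferentiable_iff]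
  exact ((((hθ 0).pow 4).add ((hθ (1 / 2)).pow 4)).div_const 2).sub ((hE'.const_mul 2).sub hE)

theorem thetaD4_sub_eisensteinLevelTwo_slash_S :
    (thetaD4 - eisensteinLevelTwo) ∣[(2 : ℤ)] S = fun τ : ℍ ↦
      -(shiftedTheta 0 τ ^ 4 + shiftedTheta (1 / 2) τ ^ 4) / 2 - (E2 (posHalf • τ) / 2 - E2 τ) := by
  ext τ
  have hτ : (τ : ℂ) ≠ 0 := ne_zero τ
  rw [slash_two_S_apply, Pi.sub_apply, thetaD4_S_smul, eisensteinLevelTwo_S_smul]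
  field_simp

theorem thetaD4_eq_eisensteinLevelTwo_of_isZeroAtImInfty
    (h0 : IsZeroAtImInfty (thetaD4 - eisensteinLevelTwo)) : thetaD4 = eisensteinLevelTwo := by
  refine sub_eq_zero.mp (eq_zero_of_weight_two_level_two
    mdifferentiable_thetaD4_sub_eisensteinLevelTwo ?_ ?_ h0 ?_)
  · ext τ
    rw [slash_two_T_apply, Pi.sub_apply, thetaD4_one_vadd, eisensteinLevelTwo_one_vadd,
      Pi.sub_apply]
  · ext τ
    have hτ : ((((1 : ℝ) +ᵥ ((1 : ℝ) +ᵥ τ) : ℍ)) : ℂ) = τ + 2 := by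
      simp
      ring
    have hhalf : posHalf • ((1 : ℝ) +ᵥ ((1 : ℝ) +ᵥ τ)) = (1 : ℝ) +ᵥ (posHalf • τ) := by
      ext
      simp
      ring
    rw [slash_two_T_apply, slash_two_T_apply, thetaD4_sub_eisensteinLevelTwo_slash_S]
    simp only [hτ, hhalf, E2_one_vadd]
    rw [shiftedTheta_add_two 0 τ 0 (by simp), shiftedTheta_add_two (1 / 2) τ 1 (by simp)]
  · rw [thetaD4_sub_eisensteinLevelTwo_slash_S]
    have hE : IsBoundedAtImInfty fun τ ↦ E2 (posHalf • τ) :=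
      isBoundedAtImInfty_E2.comp_tendsto (tendsto_pos_real_smul_atImInfty _)
    have hθ (z : ℝ) : IsBoundedAtImInfty ((fun τ : ℍ ↦ shiftedTheta z τ) ^ 4) := by
      have h := isBoundedAtImInfty_shiftedTheta z
      rw [IsBoundedAtImInfty]
      simpa only [pow_succ, pow_zero, one_mul] using
        Filter.BoundedAtFilter.mul (Filter.BoundedAtFilter.mul (Filter.BoundedAtFilter.mul h h) h) h
    have hbdd : IsBoundedAtImInfty ((-1 / 2 : ℂ) • ((fun τ : ℍ ↦ shiftedTheta (0 : ℝ) τ) ^ 4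
        + (fun τ : ℍ ↦ shiftedTheta (1 / 2 : ℝ) τ) ^ 4) - ((1 / 2 : ℂ) • (fun τ ↦ E2 (posHalf • τ))
        - E2)) :=
      (((hθ 0).add (hθ (1 / 2))).smul (-1 / 2 : ℂ)).sub ((hE.smul (1 / 2 : ℂ)).sub
        isBoundedAtImInfty_E2)
    convert hbdd using 2
    simp
    ring

/-! ### Expansions at infinity -/

theorem isZeroAtImInfty_of_hasSum_qExpansion {f : ℍ → ℂ} {c : ℕ → ℂ} (hc : c 0 = 0)
    (hf : ∀ τ : ℍ, HasSum (fun n ↦ c n * qParam 1 τ ^ n) (f τ)) : IsZeroAtImInfty f := by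
  have hq (τ : ℍ) : qParam 1 τ ≠ 0 := Function.Periodic.qParam_ne_zero _
  have hf' (τ : ℍ) : HasSum (fun n ↦ c (n + 1) • qParam 1 τ ^ n) (f τ / qParam 1 τ) := by
    have h := ((hasSum_nat_add_iff' 1).mpr (hf τ)).div_const (qParam 1 τ)
    simp only [Finset.range_one, Finset.sum_singleton, hc, zero_mul, sub_zero] at h
    refine h.congr_fun fun n ↦ ?_
    rw [smul_eq_mul, pow_succ]
    field_simp [hq τ]
  have hmul : f = (fun τ : ℍ ↦ qParam 1 τ) * fun τ ↦ f τ / qParam 1 τ := by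
    ext τ
    simp [mul_div_cancel₀ _ (hq τ)]
  rw [hmul]
  exact Filter.ZeroAtFilter.mul_boundedAtFilter (qParam_tendsto_atImInfty one_pos)
    (isBoundedAtImInfty_of_hasSum_qExpansion one_pos hf')

theorem eq_zero_of_hasSum_qExpansion_zero {c : ℕ → ℂ}
    (hc : ∀ τ : ℍ, HasSum (fun n ↦ c n * qParam 1 τ ^ n) 0) : c = 0 := by
  have hbdd : IsBoundedAtImInfty (0 : ℍ → ℂ) := Filter.const_boundedAtFilter _ 0
  have hper : Function.Periodic ((0 : ℍ → ℂ) ∘ ofComplex) (1 : ℝ) := fun _ ↦ rfl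
  have hmd : MDiff (0 : ℍ → ℂ) := mdifferentiable_const
  have han : AnalyticAt ℂ (cuspFunction 1 (0 : ℍ → ℂ)) 0 :=
    analyticAt_cuspFunction_zero one_pos hper hmd hbdd
  have hzero (τ : ℍ) : HasSum (fun n ↦ (0 : ℕ → ℂ) n • qParam 1 τ ^ n) ((0 : ℍ → ℂ) τ) := by
    simp
  have hc' (τ : ℍ) : HasSum (fun n ↦ c n • qParam 1 τ ^ n) ((0 : ℍ → ℂ) τ) := hc τ
  have hseries := (hasFPowerSeriesOnBall_cuspFunction one_pos han
    hc').hasFPowerSeriesAt.eq_formalMultilinearSeries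
      (hasFPowerSeriesOnBall_cuspFunction one_pos han hzero).hasFPowerSeriesAt
  funext n
  simpa only [FormalMultilinearSeries.coeff_ofScalars] using
    congrArg (FormalMultilinearSeries.coeff · n) hseries

theorem hasSum_E2 (τ : ℍ) :
    HasSum (fun n ↦ (if n = 0 then 1 else -24 * (σ 1 n : ℂ)) * qParam 1 τ ^ n) (E2 τ) := by
  simpa only [Function.Periodic.qParam, ofReal_one, div_one, smul_eq_mul] using
    hasSum_qExpansion_E2 (z := τ)

/-- The coefficients of the `q`-expansion of `2 E₂(2τ) - E₂(τ)`. -/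
noncomputable def eisensteinLevelTwoCoeff (n : ℕ) : ℂ :=
  (if Even n then 2 * (if n / 2 = 0 then 1 else -24 * (σ 1 (n / 2) : ℂ)) else 0)
    - (if n = 0 then 1 else -24 * (σ 1 n : ℂ))

theorem hasSum_eisensteinLevelTwo (τ : ℍ) :
    HasSum (fun n ↦ eisensteinLevelTwoCoeff n * qParam 1 τ ^ n) (eisensteinLevelTwo τ) := by
  have hq : qParam 1 ↑(posTwo • τ) = qParam 1 τ ^ 2 := by
    rw [Function.Periodic.qParam, Function.Periodic.qParam, ← Complex.exp_nat_mul]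
    congr 1
    simp
    ring
  have h1 := (hasSum_E2 (posTwo • τ)).mul_left 2
  have hinj : Function.Injective fun m : ℕ ↦ 2 * m := fun a b h ↦ by simpa using h
  have h2 : HasSum (fun n : ℕ ↦
      (if Even n then 2 * (if n / 2 = 0 then 1 else -24 * (σ 1 (n / 2) : ℂ)) else 0)
        * qParam 1 τ ^ n)
      (2 * E2 (posTwo • τ)) := by
    rw [← hinj.hasSum_iff]
    · refine h1.congr_fun fun m ↦ ?_
      rw [hq, ← pow_mul]
      simp [mul_assoc, show 2 * m ≤ 1 ↔ m = 0 by lia]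
    · intro n hn
      have : ¬ Even n := fun ⟨k, hk⟩ ↦ hn ⟨k, by simp [hk, two_mul]⟩
      simp [this]
  refine (h2.sub (hasSum_E2 τ)).congr_fun fun n ↦ ?_
  simp [eisensteinLevelTwoCoeff, sub_mul]

theorem hasSum_prod_comp_of_summable_norm {ι : Type*} {f : ι → ℂ} {a : ℂ} (h : HasSum f a)
    (hf : Summable fun x ↦ ‖f x‖) (n : ℕ) :
    HasSum (fun x : Fin n → ι ↦ ∏ i, f (x i)) (a ^ n) ∧
      Summable fun x : Fin n → ι ↦ ‖∏ i, f (x i)‖ := by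
  induction n with
  | zero => exact ⟨by simp, .of_finite⟩
  | succ n ih =>
    have hcomp : ((fun x : Fin (n + 1) → ι ↦ ∏ i, f (x i)) ∘ Fin.consEquiv fun _ ↦ ι)
        = fun p ↦ f p.1 * ∏ i, f (p.2 i) := by
      ext p
      simp [Fin.prod_univ_succ, Fin.consEquiv]
    have hnorm := hf.mul_norm ih.2
    constructor
    · rw [← (Fin.consEquiv fun _ ↦ ι).hasSum_iff, hcomp, pow_succ']
      exact HasSum.mul (g := fun x : Fin n → ι ↦ ∏ i, f (x i)) h ih.1
        (summable_mul_of_summable_norm (g := fun x : Fin n → ι ↦ ∏ i, f (x i)) hf ih.2)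
    · rw [← (Fin.consEquiv fun _ ↦ ι).summable_iff]
      exact hnorm.congr fun p ↦ congrArg norm (congrFun hcomp p).symm

/-- The checkerboard lattice `D₄`. -/
abbrev latticeD4 : Type := {x : Fin 4 → ℤ // Even (∑ i, x i)}

/-- Half the square of the Euclidean norm of a vector of `D₄`. -/
def halfNormSq (x : latticeD4) : ℕ := (∑ i, x.1 i ^ 2).toNat / 2

theorem two_mul_halfNormSq (x : latticeD4) : 2 * (halfNormSq x : ℤ) = ∑ i, x.1 i ^ 2 := by
  have heven : Even (∑ i, x.1 i ^ 2) := by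
    have h := x.2
    simp only [Fin.sum_univ_four, Int.even_add, Int.even_pow' two_ne_zero] at h ⊢
    exact h
  have hnonneg : 0 ≤ ∑ i, x.1 i ^ 2 := Finset.sum_nonneg fun i _ ↦ sq_nonneg _
  obtain ⟨k, hk⟩ := heven
  rw [halfNormSq]
  omega

theorem halfNormSq_eq_zero_iff (x : latticeD4) : halfNormSq x = 0 ↔ x.1 = 0 := by
  have h := two_mul_halfNormSq x
  constructor
  · intro h0
    rw [h0, Nat.cast_zero, mul_zero, eq_comm,
      Finset.sum_eq_zero_iff_of_nonneg fun i _ ↦ sq_nonneg _] at h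
    ext i
    simpa using h i (Finset.mem_univ i)
  · intro h0
    simpa [h0] using h

theorem hasSum_thetaD4 (τ : ℍ) :
    HasSum (fun x : latticeD4 ↦ qParam 1 τ ^ halfNormSq x) (thetaD4 τ) := by
  have hθ (z : ℂ) := (hasSum_prod_comp_of_summable_norm
    (hasSum_jacobiTheta₂_term z τ.im_pos)
    ((summable_jacobiTheta₂_term_iff z τ).mpr τ.im_pos).norm 4).1
  have hadd := ((hθ 0).add (hθ (1 / 2))).div_const 2
  have hinj := Subtype.val_injective (p := fun x : Fin 4 → ℤ ↦ Even (∑ i, x i))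
  have hprod (x : Fin 4 → ℤ) (z : ℂ) : ∏ i, jacobiTheta₂_term (x i) z τ
      = cexp (2 * π * I * z * ↑(∑ i, x i)) * cexp (π * I * τ * ↑(∑ i, x i ^ 2)) := by
    simp only [jacobiTheta₂_term]
    rw [← Complex.exp_sum, ← Complex.exp_add, Finset.sum_add_distrib]
    push_cast
    rw [Finset.mul_sum, Finset.mul_sum]
    congr 2 <;> exact Finset.sum_congr rfl fun i _ ↦ by ring
  have hhalf (k : ℤ) : cexp (2 * π * I * (1 / 2) * k) = (-1) ^ k := by
    rw [← Complex.exp_pi_mul_I, ← Complex.exp_int_mul]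
    congr 1
    ring
  rw [thetaD4]
  refine ((hinj.hasSum_iff fun x hx ↦ ?_).mpr hadd).congr_fun fun x ↦ ?_
  · have hodd : Odd (∑ i, x i) := by
      rw [← Int.not_even_iff_odd]
      exact fun h ↦ hx ⟨⟨x, h⟩, rfl⟩
    rw [hprod, hprod, hhalf, hodd.neg_one_zpow]
    simp
  · simp only [Function.comp_apply]
    rw [hprod, hprod, hhalf, x.2.neg_one_zpow, ← two_mul_halfNormSq, Function.Periodic.qParam,
      ← Complex.exp_nat_mul]
    have : (halfNormSq x : ℂ) * (2 * π * I * τ / (1 : ℝ)) =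
      π * I * τ * ↑(2 * (halfNormSq x : ℤ)) := by push_cast; ring
    rw [this]
    simp

/-- The number of vectors of square norm `2 n` in `D₄`. -/
noncomputable def countD4 (n : ℕ) : ℕ := Nat.card (halfNormSq ⁻¹' {n})

theorem hasSum_qExpansion_thetaD4 (τ : ℍ) :
    HasSum (fun n ↦ (countD4 n : ℂ) * qParam 1 τ ^ n) (thetaD4 τ) := by
  refine ((hasSum_thetaD4 τ).tsum_fiberwise halfNormSq).congr_fun fun n ↦ ?_
  rw [tsum_congr (fun b : halfNormSq ⁻¹' {n} ↦ by rw [b.2]), tsum_const, nsmul_eq_mul, countD4]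

theorem finite_halfNormSq_fiber (n : ℕ) : Finite (halfNormSq ⁻¹' {n}) := by
  have h := (hasSum_thetaD4 UpperHalfPlane.I).summable.subtype (halfNormSq ⁻¹' {n})
  have h' : Summable fun _ : halfNormSq ⁻¹' {n} ↦ qParam 1 (UpperHalfPlane.I : ℍ) ^ n :=
    h.congr fun b ↦ by rw [Function.comp_apply, b.2]
  exact .of_summable_const (norm_pos_iff.mpr (pow_ne_zero n (Function.Periodic.qParam_ne_zero _)))
    h'.norm

theorem countD4_zero : countD4 0 = 1 := by
  rw [countD4, Nat.card_eq_one_iff_unique]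
  refine ⟨⟨fun a b ↦ ?_⟩, ⟨⟨⟨0, by simp⟩, (halfNormSq_eq_zero_iff _).mpr rfl⟩⟩⟩
  ext1
  ext1
  rw [(halfNormSq_eq_zero_iff _).mp a.2, (halfNormSq_eq_zero_iff _).mp b.2]

theorem thetaD4_eq_eisensteinLevelTwo : thetaD4 = eisensteinLevelTwo :=
  thetaD4_eq_eisensteinLevelTwo_of_isZeroAtImInfty <|
    isZeroAtImInfty_of_hasSum_qExpansion (c := fun n ↦ countD4 n - eisensteinLevelTwoCoeff n)
      (by norm_num [countD4_zero, eisensteinLevelTwoCoeff]) fun τ ↦ by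
        simpa only [sub_mul, Pi.sub_apply] using
          (hasSum_qExpansion_thetaD4 τ).sub (hasSum_eisensteinLevelTwo τ)

theorem countD4_eq_eisensteinLevelTwoCoeff (n : ℕ) :
    (countD4 n : ℂ) = eisensteinLevelTwoCoeff n := by
  refine sub_eq_zero.mp (congrFun (eq_zero_of_hasSum_qExpansion_zero
    (c := fun n ↦ countD4 n - eisensteinLevelTwoCoeff n) fun τ ↦ ?_) n)
  simpa only [sub_mul, thetaD4_eq_eisensteinLevelTwo, sub_self] using
    (hasSum_qExpansion_thetaD4 τ).sub (hasSum_eisensteinLevelTwo τ)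

theorem countD4_eq_sigma {n : ℕ} (hn : n ≠ 0) :
    (countD4 n : ℝ) = 24 * σ 1 n - if Even n then 48 * (σ 1 (n / 2) : ℝ) else 0 := by
  have h := countD4_eq_eisensteinLevelTwoCoeff n
  rw [eisensteinLevelTwoCoeff, if_neg hn] at h
  rw [← ofReal_inj]
  push_cast
  rw [h]
  split_ifs with he h2
  · obtain ⟨k, rfl⟩ := he
    omega
  · push_cast
    ring
  · push_cast
    ring

/-! ### Dirichlet series -/

theorem hasSum_rzeta {s : ℝ} (hs : 1 < s) : HasSum (fun n : ℕ+ ↦ (n : ℝ) ^ (-s)) (rzeta s) :=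
  ((Real.summable_nat_rpow.mpr (neg_lt_neg hs)).comp_injective PNat.coe_injective).hasSum

theorem hasSum_sigma_one_mul_rpow {s : ℝ} (hs : 2 < s) :
    HasSum (fun n : ℕ ↦ (σ 1 n : ℝ) * (n : ℝ) ^ (-s)) (rzeta s * rzeta (s - 1)) := by
  have hz := hasSum_rzeta (s := s) (by linarith)
  have hz' := hasSum_rzeta (s := s - 1) (by linarith)
  have hprod := hz.mul hz' (hz.summable.mul_of_nonneg hz'.summable
    (fun n ↦ by positivity) fun n ↦ by positivity)
  rw [← sigmaAntidiagonalEquivProd.hasSum_iff] at hprod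
  have hσ := hprod.sigma fun n ↦ hasSum_fintype _
  rw [← PNat.coe_injective.hasSum_iff]
  · refine hσ.congr_fun fun n ↦ ?_
    have hterm (c : Nat.divisorsAntidiagonal n) :
        ((fun p : ℕ+ × ℕ+ ↦ ((p.1 : ℕ) : ℝ) ^ (-s) * ((p.2 : ℕ) : ℝ) ^ (-(s - 1))) ∘
          sigmaAntidiagonalEquivProd) ⟨n, c⟩ = c.1.2 * (n : ℝ) ^ (-s) := by
      have hc := Nat.mem_divisorsAntidiagonal.mp c.2
      have h2 : (0 : ℝ) < c.1.2 := by
        have : c.1.2 ≠ 0 := fun h ↦ hc.2 (by rw [← hc.1, h, mul_zero])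
        positivity
      have hn : ((n : ℕ) : ℝ) = c.1.1 * c.1.2 := mod_cast hc.1.symm
      rw [hn, Real.mul_rpow (by positivity) h2.le]
      simp only [sigmaAntidiagonalEquivProd, Function.comp_apply, Equiv.coe_fn_mk,
        divisorsAntidiagonalFactors, PNat.mk_coe]
      rw [neg_sub, sub_eq_add_neg, Real.rpow_add h2, Real.rpow_one]
      ring
    simp only [hterm, ← Finset.sum_mul, Function.comp_apply]
    congr 1
    rw [Finset.univ_eq_attach, Finset.sum_attach _ fun x : ℕ × ℕ ↦ (x.2 : ℝ),
      Nat.sum_divisorsAntidiagonal' fun _ y ↦ (y : ℝ), ArithmeticFunction.sigma_one_apply]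
    push_cast
    rfl
  · intro n hn
    have : n = 0 := by
      by_contra h
      exact hn ⟨⟨n, Nat.pos_of_ne_zero h⟩, rfl⟩
    simp [this]

theorem tsum_comp_eq_tsum_card_mul {α : Type*} {N : α → ℕ}
    (hN : ∀ n, Finite (N ⁻¹' {n})) {f : ℕ → ℝ} (hf : ∀ n, 0 ≤ f n) :
    ∑' x, f (N x) = ∑' n, (Nat.card (N ⁻¹' {n}) : ℝ) * f n := by
  have hfib (n : ℕ) : ∑' x : N ⁻¹' {n}, ENNReal.ofReal (f (N x)) =
      ENNReal.ofReal (Nat.card (N ⁻¹' {n}) * f n) := by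
    have := Fintype.ofFinite (N ⁻¹' {n})
    rw [tsum_congr (fun b : N ⁻¹' {n} ↦ by rw [b.2]), tsum_fintype, Finset.sum_const,
      nsmul_eq_mul, ENNReal.ofReal_mul (by positivity), ENNReal.ofReal_natCast,
      Finset.card_univ, Nat.card_eq_fintype_card]
  have h := ENNReal.tsum_fiberwise (fun x ↦ ENNReal.ofReal (f (N x))) N
  simp only [hfib] at h
  have h' := congrArg ENNReal.toReal h
  rw [ENNReal.tsum_toReal_eq fun _ ↦ ENNReal.ofReal_ne_top,
    ENNReal.tsum_toReal_eq fun _ ↦ ENNReal.ofReal_ne_top] at h'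
  simpa only [ENNReal.toReal_ofReal (hf _),
    ENNReal.toReal_ofReal (mul_nonneg (Nat.cast_nonneg _) (hf _))] using h'.symm

theorem hasSum_countD4_mul_rpow {s : ℝ} (hs : 2 < s) :
    HasSum (fun n : ℕ ↦ (countD4 n : ℝ) * (2 * n : ℝ) ^ (-s))
      (24 * 2 ^ (-s) * (1 - 2 * 2 ^ (-s)) * (rzeta s * rzeta (s - 1))) := by
  have hσ := hasSum_sigma_one_mul_rpow hs
  have hinj : Function.Injective fun m : ℕ ↦ 2 * m := fun a b h ↦ by simpa using h
  have heven : HasSum (fun n : ℕ ↦ (if Even n then (σ 1 (n / 2) : ℝ) else 0) * (n : ℝ) ^ (-s))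
      (2 ^ (-s) * (rzeta s * rzeta (s - 1))) := by
    rw [← hinj.hasSum_iff]
    · refine (hσ.mul_left (2 ^ (-s))).congr_fun fun m ↦ ?_
      simp only [Function.comp_apply, even_two_mul, if_true, Nat.cast_mul, Nat.cast_ofNat,
        Nat.mul_div_cancel_left m two_pos]
      rw [Real.mul_rpow two_pos.le m.cast_nonneg]
      ring
    · intro n hn
      have : ¬ Even n := fun ⟨k, hk⟩ ↦ hn ⟨k, by simp [hk, two_mul]⟩
      simp [this]
  have h := ((hσ.mul_left 24).sub (heven.mul_left 48)).mul_left (2 ^ (-s))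
  rw [show 24 * 2 ^ (-s) * (1 - 2 * 2 ^ (-s)) * (rzeta s * rzeta (s - 1)) =
    2 ^ (-s) * (24 * (rzeta s * rzeta (s - 1)) - 48 * (2 ^ (-s) * (rzeta s * rzeta (s - 1)))) by
      ring]
  refine h.congr_fun fun n ↦ ?_
  rcases eq_or_ne n 0 with rfl | hn
  · simp [Real.zero_rpow (show -s ≠ 0 by linarith)]
  · rw [countD4_eq_sigma hn, Real.mul_rpow two_pos.le n.cast_nonneg]
    split_ifs <;> ring

theorem tsum_ne_zero_eq_tsum_latticeD4 {s : ℝ} (hs : s ≠ 0) :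
    ∑' x : {x : Fin 4 → ℤ // Even (∑ i, x i) ∧ x ≠ 0}, (∑ i, ((x.1 i : ℝ)) ^ 2) ^ (-s) =
      ∑' x : latticeD4, (2 * halfNormSq x : ℝ) ^ (-s) := by
  have hnorm (x : latticeD4) : (2 * halfNormSq x : ℝ) = ∑ i, (x.1 i : ℝ) ^ 2 := by
    exact_mod_cast two_mul_halfNormSq x
  have hinj : Function.Injective
      fun x : {x : Fin 4 → ℤ // Even (∑ i, x i) ∧ x ≠ 0} ↦ (⟨x.1, x.2.1⟩ : latticeD4) :=
    fun a b h ↦ Subtype.ext (congrArg (fun y : latticeD4 ↦ y.1) h)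
  rw [← hinj.tsum_eq]
  · simp only [hnorm]
  · intro x hx
    refine ⟨⟨x.1, x.2, fun h0 ↦ hx ?_⟩, rfl⟩
    simp [(halfNormSq_eq_zero_iff x).mpr h0, Real.zero_rpow (neg_ne_zero.mpr hs)]

end

/-- For every real number `s > 2`, the Epstein zeta function of the checkerboard lattice
`D₄ = {x ∈ ℤ⁴ : x₁ + x₂ + x₃ + x₄ even}` satisfies
`ζ_{D₄}(s) = 3 · 4^{2-s} (2^{s-1} - 1) ζ(s) ζ(s-1)`. -/
theorem epstein_zeta_D4 (s : ℝ) (hs : 2 < s) :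
    ∑' x : {x : Fin 4 → ℤ // Even (∑ i, x i) ∧ x ≠ 0}, (∑ i, ((x.1 i : ℝ)) ^ 2) ^ (-s)
      = 3 * (4 : ℝ) ^ (2 - s) * ((2 : ℝ) ^ (s - 1) - 1) * rzeta s * rzeta (s - 1) := by
  rw [tsum_ne_zero_eq_tsum_latticeD4 (by linarith),
    tsum_comp_eq_tsum_card_mul finite_halfNormSq_fiber
      (f := fun n ↦ (2 * n : ℝ) ^ (-s)) (fun n ↦ by positivity)]
  refine (hasSum_countD4_mul_rpow hs).tsum_eq.trans ?_
  have h4 : (4 : ℝ) ^ (2 - s) = 16 * (2 ^ (-s) * 2 ^ (-s)) := by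
    rw [← Real.mul_rpow two_pos.le two_pos.le, sub_eq_add_neg, Real.rpow_add four_pos]
    norm_num
  have h2 : (2 : ℝ) ^ (s - 1) = 2 ^ s / 2 := by rw [Real.rpow_sub two_pos, Real.rpow_one]
  have hpos : (2 : ℝ) ^ s ≠ 0 := by positivity
  rw [h4, h2, Real.rpow_neg two_pos.le]
  field_simp
  ring
end

section
/- Let a be a real number with 0 < a < 1 and let s > 2 be real. Then Σ_{x ∈ ℤ⁴} (a + ‖x‖²)^{−s} = a^{−s} + Σ_{k=0}^{∞} ((−1)^k a^k / k!) · (Γ(s+k)/Γ(s)) · ζ_{ℤ⁴}(s+k). -/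
open scoped BigOperators

/-- The Epstein zeta function of the lattice `ℤ⁴`. -/
noncomputable def epsteinZ4 (s : ℝ) : ℝ :=
  ∑' x : {x : Fin 4 → ℤ // x ≠ 0}, (∑ i, ((x.1 i : ℝ)) ^ 2) ^ (-s)

theorem Real.Gamma_add_nat_div_Gamma {s : ℝ} (hs : 0 < s) (k : ℕ) :
    Real.Gamma (s + k) / Real.Gamma s = (ascPochhammer ℝ k).eval s := by
  rw [div_eq_iff (Real.Gamma_pos_of_pos hs).ne']
  induction k with
  | zero => simp
  | succ k ih =>
    rw [ascPochhammer_succ_eval, mul_right_comm, ← ih, Nat.cast_succ, ← add_assoc,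
      Real.Gamma_add_one (by positivity), mul_comm]

theorem Real.ringChoose_add_sub_one_eq_Gamma {s : ℝ} (hs : 0 < s) (k : ℕ) :
    Ring.choose (s + k - 1) k = Real.Gamma (s + k) / Real.Gamma s / (k.factorial : ℝ) := by
  have h := Ring.descPochhammer_eq_factorial_smul_choose (s + k - 1) k
  rw [Polynomial.descPochhammer_smeval_eq_ascPochhammer, show s + k - 1 - k + 1 = s by ring,
    Polynomial.ascPochhammer_smeval_eq_eval, nsmul_eq_mul] at h
  rw [Real.Gamma_add_nat_div_Gamma hs, h, mul_div_cancel_left₀ _ (by positivity)]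

theorem Real.hasSum_one_sub_rpow_neg {s t : ℝ} (hs : 0 < s) (ht : |t| < 1) :
    HasSum (fun k : ℕ ↦ Real.Gamma (s + k) / Real.Gamma s / (k.factorial : ℝ) * t ^ k)
      ((1 - t) ^ (-s)) := by
  have h := (Real.one_div_one_sub_rpow_hasFPowerSeriesOnBall_zero s).hasSum (y := t)
    (by simpa [enorm_eq_nnnorm] using! ht)
  rw [zero_add, one_div, ← Real.rpow_neg (by linarith [(abs_lt.mp ht).2])] at h
  simpa [Real.ringChoose_add_sub_one_eq_Gamma hs, mul_comm]
    using h

theorem Real.hasSum_add_rpow_neg {s a q : ℝ} (hs : 0 < s) (ha : |a| < q) :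
    HasSum (fun k : ℕ ↦ (-1 : ℝ) ^ k * a ^ k / (k.factorial : ℝ) *
      (Real.Gamma (s + k) / Real.Gamma s) * q ^ (-(s + k))) ((a + q) ^ (-s)) := by
  have hq : 0 < q := (abs_nonneg a).trans_lt ha
  have ht : |-(a / q)| < 1 := by
    rwa [abs_neg, abs_div, abs_of_pos hq, div_lt_one hq]
  have h := (Real.hasSum_one_sub_rpow_neg hs ht).mul_right (q ^ (-s))
  have hpos : 0 ≤ 1 - -(a / q) := by linarith [(abs_lt.mp ht).2]
  rw [← Real.mul_rpow hpos hq.le, show (1 - -(a / q)) * q = a + q by field_simp; ring] at h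
  suffices heq : (fun k : ℕ ↦ (-1 : ℝ) ^ k * a ^ k / (k.factorial : ℝ) *
      (Real.Gamma (s + k) / Real.Gamma s) * q ^ (-(s + k))) = fun k : ℕ ↦
      Real.Gamma (s + k) / Real.Gamma s / (k.factorial : ℝ) * (-(a / q)) ^ k * q ^ (-s) from
    heq ▸ h
  funext k
  rw [neg_add, Real.rpow_add hq, Real.rpow_neg_natCast, zpow_neg, zpow_natCast, neg_pow (a / q), div_pow]
  field_simp

theorem one_le_sum_sq_intCast {ι : Type*} [Fintype ι] {x : ι → ℤ} (hx : x ≠ 0) :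
    (1 : ℝ) ≤ ∑ i, (x i : ℝ) ^ 2 := by
  obtain ⟨i, hi⟩ := Function.ne_iff.mp hx
  refine le_trans ?_ (Finset.single_le_sum (fun j _ ↦ sq_nonneg (x j : ℝ)) (Finset.mem_univ i))
  exact_mod_cast Int.add_one_le_iff.mpr (sq_pos_of_ne_zero hi)

theorem summable_norm_intCast_rpow {ι : Type*} [Fintype ι] {r : ℝ} (hr : r < -Fintype.card ι) :
    Summable fun x : ι → ℤ ↦ ‖fun i ↦ (x i : ℝ)‖ ^ r := by
  have hL : Module.finrank ℤ (Submodule.span ℤ (Set.range (Pi.basisFun ℝ ι))) = Fintype.card ι :=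
    Module.finrank_eq_card_basis ((Pi.basisFun ℝ ι).restrictScalars ℤ)
  have h := ZLattice.summable_norm_rpow (Submodule.span ℤ (Set.range (Pi.basisFun ℝ ι))) r
    (by rwa [hL])
  have hmem (x : ι → ℤ) :
      (fun i ↦ (x i : ℝ)) ∈ Submodule.span ℤ (Set.range (Pi.basisFun ℝ ι)) :=
    ((Pi.basisFun ℝ ι).mem_span_iff_repr_mem ℤ _).mpr fun i ↦ ⟨x i, by simp⟩
  have hinj : Function.Injective fun x : ι → ℤ ↦
      (⟨_, hmem x⟩ : Submodule.span ℤ (Set.range (Pi.basisFun ℝ ι))) := fun x y hxy ↦ by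
    ext i
    have h : (x i : ℝ) = y i := congrFun (congrArg Subtype.val hxy) i
    exact_mod_cast h
  exact (h.comp_injective hinj).congr fun x ↦ by
    rw [Function.comp_apply, Submodule.coe_norm]

theorem summable_sum_sq_intCast_rpow_neg {ι : Type*} [Fintype ι] {s : ℝ}
    (hs : Fintype.card ι < 2 * s) :
    Summable fun x : {x : ι → ℤ // x ≠ 0} ↦ (∑ i, (x.1 i : ℝ) ^ 2) ^ (-s) := by
  refine .of_nonneg_of_le (fun x ↦ by positivity) (fun x ↦ ?_)
    ((summable_norm_intCast_rpow (ι := ι) (r := -(2 * s)) (by linarith)).subtype {x | x ≠ 0})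
  have hs0 : 0 < s := by linarith [(Fintype.card ι).cast_nonneg (α := ℝ)]
  have hx : 0 < ‖fun i ↦ (x.1 i : ℝ)‖ := by
    refine norm_pos_iff.mpr fun h ↦ x.2 (funext fun i ↦ ?_)
    simpa using! congrFun h i
  have hle : ‖fun i ↦ (x.1 i : ℝ)‖ ^ 2 ≤ ∑ i, (x.1 i : ℝ) ^ 2 := by
    refine (Real.le_sqrt' hx).mp ?_
    refine (pi_norm_le_iff_of_nonneg (Real.sqrt_nonneg _)).mpr fun i ↦ Real.abs_le_sqrt ?_
    exact Finset.single_le_sum (fun j _ ↦ sq_nonneg (x.1 j : ℝ)) (Finset.mem_univ i)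
  calc (∑ i, (x.1 i : ℝ) ^ 2) ^ (-s)
      ≤ (‖fun i ↦ (x.1 i : ℝ)‖ ^ 2) ^ (-s) :=
        Real.rpow_le_rpow_of_nonpos (by positivity) hle (by linarith)
    _ = ‖fun i ↦ (x.1 i : ℝ)‖ ^ (-(2 * s)) := by
        rw [← Real.rpow_natCast, ← Real.rpow_mul hx.le]; norm_num

theorem summable_binomial_mul_rpow_neg {X : Type*} {q : X → ℝ} {a s : ℝ} (hs : 0 < s)
    (ha : |a| < 1) (hq : ∀ x, 1 ≤ q x) (hsum : Summable fun x ↦ q x ^ (-s)) :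
    Summable fun p : X × ℕ ↦ (-1 : ℝ) ^ p.2 * a ^ p.2 / (p.2.factorial : ℝ) *
      (Real.Gamma (s + p.2) / Real.Gamma s) * q p.1 ^ (-(s + p.2)) := by
  have hΓ (k : ℕ) : 0 ≤ Real.Gamma (s + k) / Real.Gamma s :=
    div_nonneg (Real.Gamma_pos_of_pos (by positivity)).le (Real.Gamma_pos_of_pos hs).le
  have hc := (Real.hasSum_one_sub_rpow_neg hs (by rwa [abs_abs] : |(|a|)| < 1)).summable
  refine .of_norm_bounded (hsum.mul_of_nonneg hc
    (fun x ↦ Real.rpow_nonneg (zero_le_one.trans (hq x)) _)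
    (fun k ↦ mul_nonneg (div_nonneg (hΓ k) (by positivity)) (by positivity))) fun ⟨x, k⟩ ↦ ?_
  have hx : 0 ≤ q x := zero_le_one.trans (hq x)
  calc ‖(-1 : ℝ) ^ k * a ^ k / (k.factorial : ℝ) *
        (Real.Gamma (s + k) / Real.Gamma s) * q x ^ (-(s + k))‖
      = q x ^ (-(s + k)) * (Real.Gamma (s + k) / Real.Gamma s / (k.factorial : ℝ) * |a| ^ k) := by
        rw [norm_mul, norm_mul, norm_div, norm_mul, norm_pow, norm_pow, norm_neg, norm_one,
          one_pow, one_mul, Real.norm_of_nonneg (hΓ k), Real.norm_of_nonneg (Real.rpow_nonneg hx _),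
          Real.norm_eq_abs a, Real.norm_of_nonneg (Nat.cast_nonneg _)]
        ring
    _ ≤ _ := by
        have := hΓ k
        have : q x ^ (-(s + k)) ≤ q x ^ (-s) :=
          Real.rpow_le_rpow_of_exponent_le (hq x) (by linarith [k.cast_nonneg (α := ℝ)])
        dsimp only
        gcongr

/-- For `0 < a < 1` and real `s > 2`,
`∑_{x ∈ ℤ⁴} (a+‖x‖²)^{-s} = a^{-s} + ∑_{k≥0} ((-1)^k a^k/k!) (Γ(s+k)/Γ(s)) ζ_{ℤ⁴}(s+k)`. -/
theorem hurwitz_epstein_Z4_one (a : ℝ) (ha : 0 < a) (ha1 : a < 1) (s : ℝ) (hs : 2 < s) :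
    ∑' x : Fin 4 → ℤ, (a + ∑ i, ((x i : ℝ)) ^ 2) ^ (-s)
      = a ^ (-s)
        + ∑' k : ℕ, (-1 : ℝ) ^ k * a ^ k / (k.factorial : ℝ) *
            (Real.Gamma (s + k) / Real.Gamma s) * epsteinZ4 (s + k) := by
  have hs0 : 0 < s := by linarith
  have haabs : |a| < 1 := by rwa [abs_of_pos ha]
  have hq (x : {x : Fin 4 → ℤ // x ≠ 0}) := one_le_sum_sq_intCast x.2
  have hS := summable_binomial_mul_rpow_neg hs0 haabs hq
    (summable_sum_sq_intCast_rpow_neg (by norm_num; linarith))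
  have hrow (x : {x : Fin 4 → ℤ // x ≠ 0}) :=
    Real.hasSum_add_rpow_neg hs0 (haabs.trans_le (hq x))
  have hsub : Summable fun x : {x : Fin 4 → ℤ // x ≠ 0} ↦
      (a + ∑ i, (x.1 i : ℝ) ^ 2) ^ (-s) :=
    (hS.prod).congr fun x ↦ (hrow x).tsum_eq
  have hsplit := ((Set.finite_singleton (0 : Fin 4 → ℤ)).summable _).tsum_add_tsum_compl
    (f := fun x : Fin 4 → ℤ ↦ (a + ∑ i, (x i : ℝ) ^ 2) ^ (-s)) hsub
  rw [← hsplit]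
  congr 1
  · rw [tsum_singleton (0 : Fin 4 → ℤ) fun x ↦ (a + ∑ i, (x i : ℝ) ^ 2) ^ (-s)]
    simp
  · simp_rw [epsteinZ4, ← tsum_mul_left]
    exact (tsum_congr fun x ↦ (hrow x).tsum_eq.symm).trans (Summable.tsum_comm hS).symm
end

section
/- For every real number s > 2, the ratio of the Epstein zeta function of ℤ⁴ to that of the lattice D₄ rescaled by μ = 2^{−1/4} (so that its fundamental volume is 1) is ζ_{ℤ⁴}(s) / ζ_{2^{−1/4}·D₄}(s) = (2^{s−1} + 1)/(3·2^{s/2 − 1}). In particular, for s = 2nₑ + 4 with nₑ a natural number, this ratio equals (2^{2nₑ+3} + 1)/(3·2^{nₑ+1}). -/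
open scoped BigOperators

/-- The Epstein zeta function of the checkerboard lattice `D₄` rescaled by `μ > 0`,
i.e. `∑_{x ∈ D₄, x ≠ 0} (μ²‖x‖²)^{-s}`. -/
noncomputable def epsteinD4Scaled (μ s : ℝ) : ℝ :=
  ∑' x : {x : Fin 4 → ℤ // Even (∑ i, x i) ∧ x ≠ 0},
    (μ ^ 2 * ∑ i, ((x.1 i : ℝ)) ^ 2) ^ (-s)

/-- The summand of the Epstein zeta function of `ℤ⁴`, extended to the origin. -/
noncomputable def epsteinTerm (s : ℝ) (x : Fin 4 → ℤ) : ℝ :=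
  (∑ i, (x i : ℝ) ^ 2) ^ (-s)

lemma epsteinTerm_nonneg (s : ℝ) (x : Fin 4 → ℤ) : 0 ≤ epsteinTerm s x := by
  unfold epsteinTerm
  positivity

lemma epsteinTerm_zero {s : ℝ} (hs : s ≠ 0) : epsteinTerm s 0 = 0 := by
  simp [epsteinTerm, Real.zero_rpow (neg_ne_zero.mpr hs)]

lemma summable_epsteinTerm {s : ℝ} (hs : 2 < s) : Summable (epsteinTerm s) := by
  let b := (EuclideanSpace.basisFun (Fin 4) ℝ).toBasis
  let c := b.restrictScalars ℤ
  have hrank : Module.finrank ℤ (Submodule.span ℤ (Set.range b)) = 4 := by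
    simpa using Module.finrank_eq_card_basis c
  have hsum := (ZLattice.summable_norm_rpow (Submodule.span ℤ (Set.range b)) (-(2 * s))
    (by rw [hrank]; push_cast; linarith)).comp_injective c.equivFun.symm.injective
  refine hsum.congr fun x => ?_
  have hx : ∀ i, ((c.equivFun.symm x : Submodule.span ℤ (Set.range b)) :
      EuclideanSpace ℝ (Fin 4)) i = x i := by
    intro i
    have hc : ∀ j, ((c j : Submodule.span ℤ (Set.range b)) : EuclideanSpace ℝ (Fin 4)) =
        EuclideanSpace.single j 1 := fun j =>
      (b.restrictScalars_apply ℤ j).trans (by simp [b])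
    rw [Module.Basis.equivFun_symm_apply]
    simp only [Submodule.coe_sum, Submodule.coe_smul, hc]
    simp [Pi.single_apply]
  have hnorm : ‖c.equivFun.symm x‖ = √(∑ i, (x i : ℝ) ^ 2) := by
    rw [Submodule.coe_norm, EuclideanSpace.norm_eq]
    simp only [hx, Real.norm_eq_abs, sq_abs]
  rw [Function.comp_apply, hnorm, epsteinTerm, Real.sqrt_eq_rpow, ← Real.rpow_mul (by positivity)]
  congr 1
  ring

/-- The similarity `(a, b, c, d) ↦ (a + b, a - b, c + d, c - d)` of `ℤ⁴`, of norm `2`, with the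
coordinates of the image permuted by `σ`. -/
def doublingMap (σ : Equiv.Perm (Fin 4)) (x : Fin 4 → ℤ) : Fin 4 → ℤ :=
  ![x 0 + x 1, x 0 - x 1, x 2 + x 3, x 2 - x 3] ∘ σ

lemma doublingMap_injective (σ : Equiv.Perm (Fin 4)) : Function.Injective (doublingMap σ) := by
  intro x y h
  have h' := σ.surjective.injective_comp_right h
  have h0 := congrFun h' 0
  have h1 := congrFun h' 1
  have h2 := congrFun h' 2
  have h3 := congrFun h' 3
  simp at h0 h1 h2 h3
  ext i
  fin_cases i <;> simp <;> omega

lemma epsteinTerm_doublingMap (s : ℝ) (σ : Equiv.Perm (Fin 4)) (x : Fin 4 → ℤ) :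
    epsteinTerm s (doublingMap σ x) = 2 ^ (-s) * epsteinTerm s x := by
  have h : ∑ i, (doublingMap σ x i : ℝ) ^ 2 = 2 * ∑ i, (x i : ℝ) ^ 2 := by
    rw [show ∑ i, (doublingMap σ x i : ℝ) ^ 2 = ∑ i, (doublingMap (.refl _) x i : ℝ) ^ 2 from
      Equiv.sum_comp σ fun i => (doublingMap (.refl _) x i : ℝ) ^ 2]
    simp [doublingMap, Fin.sum_univ_four]
    ring
  rw [epsteinTerm, h, Real.mul_rpow (by norm_num) (by positivity), epsteinTerm]

lemma mem_range_doublingMap {σ : Equiv.Perm (Fin 4)} {y : Fin 4 → ℤ} :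
    y ∈ Set.range (doublingMap σ) ↔
      Even (y (σ.symm 0) + y (σ.symm 1)) ∧ Even (y (σ.symm 2) + y (σ.symm 3)) := by
  constructor
  · rintro ⟨x, rfl⟩
    exact ⟨⟨x 0, by simp [doublingMap]⟩, ⟨x 2, by simp [doublingMap]⟩⟩
  · rintro ⟨⟨a, ha⟩, ⟨c, hc⟩⟩
    refine ⟨![a, y (σ.symm 0) - a, c, y (σ.symm 2) - c], ?_⟩
    ext i
    obtain ⟨j, rfl⟩ := σ.symm.surjective i
    simp only [doublingMap, Function.comp_apply, Equiv.apply_symm_apply]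
    fin_cases j <;> simp <;> omega

lemma tsum_indicator_range_doublingMap (s : ℝ) (σ : Equiv.Perm (Fin 4)) :
    ∑' y, (Set.range (doublingMap σ)).indicator (epsteinTerm s) y =
      2 ^ (-s) * ∑' x, epsteinTerm s x := by
  rw [← tsum_subtype, tsum_range _ (doublingMap_injective σ), ← tsum_mul_left]
  simp only [epsteinTerm_doublingMap]

/-- The checkerboard lattice `D₄`, as a set of integer vectors. -/
def checkerboardSet : Set (Fin 4 → ℤ) := {x | Even (∑ i, x i)}

lemma mem_checkerboardSet {x : Fin 4 → ℤ} : x ∈ checkerboardSet ↔ Even (∑ i, x i) := Iff.rfl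

lemma tsum_indicator_image_checkerboardSet (s : ℝ) :
    ∑' y, (doublingMap (.refl _) '' checkerboardSet).indicator (epsteinTerm s) y =
      2 ^ (-s) * ∑' x, checkerboardSet.indicator (epsteinTerm s) x := by
  rw [← tsum_subtype, tsum_image _ (doublingMap_injective (.refl _)).injOn, ← tsum_subtype,
    ← tsum_mul_left]
  simp only [epsteinTerm_doublingMap]

lemma mem_image_checkerboardSet {y : Fin 4 → ℤ} :
    y ∈ doublingMap (.refl _) '' checkerboardSet ↔
      Even (y 0 + y 1) ∧ Even (y 0 + y 2) ∧ Even (y 0 + y 3) := by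
  constructor
  · rintro ⟨x, hx, rfl⟩
    simp only [mem_checkerboardSet, Fin.sum_univ_four] at hx
    simp [doublingMap]
    grind
  · rintro ⟨h1, h2, h3⟩
    obtain ⟨x, rfl⟩ : y ∈ Set.range (doublingMap (.refl _)) :=
      mem_range_doublingMap.mpr (by simp only [Equiv.refl_symm, Equiv.refl_apply]; grind)
    refine ⟨x, ?_, rfl⟩
    simp [doublingMap] at h1 h2 h3
    simp only [mem_checkerboardSet, Fin.sum_univ_four]
    grind

lemma checkerboardSet_indicator_add (f : (Fin 4 → ℤ) → ℝ) (y : Fin 4 → ℤ) :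
    checkerboardSet.indicator f y + 2 * (doublingMap (.refl _) '' checkerboardSet).indicator f y =
      (Set.range (doublingMap (.refl _))).indicator f y +
        (Set.range (doublingMap (Equiv.swap 1 2))).indicator f y +
        (Set.range (doublingMap (Equiv.swap 1 3))).indicator f y := by
  classical
  have e0 : Equiv.swap (1 : Fin 4) 2 0 = 0 := by decide
  have e3 : Equiv.swap (1 : Fin 4) 2 3 = 3 := by decide
  have e0' : Equiv.swap (1 : Fin 4) 3 0 = 0 := by decide
  have e2' : Equiv.swap (1 : Fin 4) 3 2 = 2 := by decide
  simp only [Set.indicator_apply, mem_image_checkerboardSet, mem_range_doublingMap,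
    mem_checkerboardSet, Fin.sum_univ_four, Equiv.symm_swap, Equiv.swap_apply_left,
    Equiv.swap_apply_right, e0, e3, e0', e2', Equiv.refl_symm, Equiv.refl_apply,
    Int.even_add]
  by_cases h0 : Even (y 0) <;> by_cases h1 : Even (y 1) <;> by_cases h2 : Even (y 2) <;>
    by_cases h3 : Even (y 3) <;> simp [h0, h1, h2, h3] <;> ring

lemma checkerboardSet_tsum_relation {s : ℝ} (hs : 2 < s) :
    (2 ^ s + 2) * ∑' x, checkerboardSet.indicator (epsteinTerm s) x =
      3 * ∑' x, epsteinTerm s x := by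
  have hi (A : Set (Fin 4 → ℤ)) := (summable_epsteinTerm hs).indicator A
  have h := tsum_congr (L := .unconditional _) (checkerboardSet_indicator_add (epsteinTerm s))
  rw [(hi _).tsum_add ((hi _).mul_left 2), ((hi _).add (hi _)).tsum_add (hi _),
    (hi _).tsum_add (hi _), tsum_mul_left, tsum_indicator_image_checkerboardSet] at h
  simp only [tsum_indicator_range_doublingMap] at h
  have h2 : (2 : ℝ) ^ s * 2 ^ (-s) = 1 := by
    rw [← Real.rpow_add two_pos, add_neg_cancel, Real.rpow_zero]
  linear_combination 2 ^ s * h + (3 * ∑' x, epsteinTerm s x -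
    2 * ∑' x, checkerboardSet.indicator (epsteinTerm s) x) * h2

lemma tsum_checkerboardSet_pos {s : ℝ} (hs : 2 < s) :
    0 < ∑' x, checkerboardSet.indicator (epsteinTerm s) x := by
  refine ((summable_epsteinTerm hs).indicator _).tsum_pos
    (Set.indicator_nonneg fun x _ => epsteinTerm_nonneg s x) ![1, 1, 0, 0] ?_
  rw [Set.indicator_of_mem]
  · simp only [epsteinTerm, Fin.sum_univ_four]
    norm_num
    positivity
  · simp only [mem_checkerboardSet, Fin.sum_univ_four]
    decide

lemma epsteinZ4_eq_tsum {s : ℝ} (hs : s ≠ 0) : epsteinZ4 s = ∑' x, epsteinTerm s x := by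
  refine tsum_subtype_eq_of_support_subset (f := epsteinTerm s) (s := {x | x ≠ 0}) ?_
  rintro x hx rfl
  exact hx (epsteinTerm_zero hs)

lemma epsteinD4Scaled_eq_tsum {s : ℝ} (hs : s ≠ 0) (μ : ℝ) :
    epsteinD4Scaled μ s =
      (μ ^ 2) ^ (-s) * ∑' x, checkerboardSet.indicator (epsteinTerm s) x := by
  have h : ∑' x : {x : Fin 4 → ℤ // Even (∑ i, x i) ∧ x ≠ 0}, epsteinTerm s x.1 =
      ∑' x, checkerboardSet.indicator (epsteinTerm s) x := by
    rw [show ∑' x : {x : Fin 4 → ℤ // Even (∑ i, x i) ∧ x ≠ 0}, epsteinTerm s x.1 = _ from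
      tsum_subtype {x : Fin 4 → ℤ | Even (∑ i, x i) ∧ x ≠ 0} (epsteinTerm s)]
    refine tsum_congr fun x => ?_
    classical
    by_cases hx : x = 0
    · rw [hx, Set.indicator_of_notMem (by simp), Set.indicator_apply, epsteinTerm_zero hs,
        ite_self]
    · simp [hx, Set.indicator_apply, checkerboardSet]
  rw [← h, ← tsum_mul_left]
  refine tsum_congr fun x => ?_
  rw [epsteinTerm, Real.mul_rpow (by positivity) (by positivity)]

lemma epsteinZ4_div_epsteinD4Scaled {s : ℝ} (hs : 2 < s) :
    epsteinZ4 s / epsteinD4Scaled ((2 : ℝ) ^ (-(1 / 4 : ℝ))) s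
      = ((2 : ℝ) ^ (s - 1) + 1) / (3 * (2 : ℝ) ^ (s / 2 - 1)) := by
  have hs0 : s ≠ 0 := by linarith
  have hμ : (((2 : ℝ) ^ (-(1 / 4 : ℝ))) ^ 2) ^ (-s) = 2 ^ (s / 2) := by
    rw [← Real.rpow_natCast, ← Real.rpow_mul two_pos.le, ← Real.rpow_mul two_pos.le]
    congr 1
    push_cast
    ring
  have hD := tsum_checkerboardSet_pos hs
  have hrel := checkerboardSet_tsum_relation hs
  have hp : (0 : ℝ) < 2 ^ (s / 2) := by positivity
  rw [epsteinZ4_eq_tsum hs0, epsteinD4Scaled_eq_tsum hs0, hμ, Real.rpow_sub_one two_ne_zero,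
    Real.rpow_sub_one two_ne_zero, div_eq_div_iff (by positivity) (by positivity)]
  linear_combination -(2 ^ (s / 2) / 2) * hrel

/-- For real `s > 2`, the ratio of the Epstein zeta function of `ℤ⁴` to that of `D₄`
rescaled by `μ = 2^{-1/4}` is `(2^{s-1} + 1)/(3 · 2^{s/2-1})`; in particular for
`s = 2nₑ + 4` it equals `(2^{2nₑ+3} + 1)/(3 · 2^{nₑ+1})`. -/
theorem epstein_ratio_Z4_D4 (s : ℝ) (hs : 2 < s) :
    (epsteinZ4 s / epsteinD4Scaled ((2 : ℝ) ^ (-(1 / 4 : ℝ))) s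
      = ((2 : ℝ) ^ (s - 1) + 1) / (3 * (2 : ℝ) ^ (s / 2 - 1))) ∧
    (∀ ne : ℕ, s = 2 * (ne : ℝ) + 4 →
      epsteinZ4 s / epsteinD4Scaled ((2 : ℝ) ^ (-(1 / 4 : ℝ))) s
        = ((2 : ℝ) ^ (2 * ne + 3) + 1) / (3 * (2 : ℝ) ^ (ne + 1))) := by
  refine ⟨epsteinZ4_div_epsteinD4Scaled hs, fun ne hne => ?_⟩
  rw [epsteinZ4_div_epsteinD4Scaled hs,
    show s - 1 = ((2 * ne + 3 : ℕ) : ℝ) by rw [hne]; push_cast; ring,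
    show s / 2 - 1 = ((ne + 1 : ℕ) : ℝ) by rw [hne]; push_cast; ring,
    Real.rpow_natCast, Real.rpow_natCast]
end
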